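/- arXiv:1305.2810 — 4 statements merged into one kernel-verified Lean document; each statement's English description precedes it below -/
import Mathlib

section
/- Let Ω ⊂ ℝ² be a nonempty open bounded connected and simply connected domain of class C² such that H(Ω) = Cut(Ω) =: S. Then S is a singleton {p}, and Ω is the open disk of center p and radius ρ_Ω := max over the closure of Ω of d_{∂Ω}. -/
open Metric Set Real

noncomputable section

abbrev E2 := EuclideanSpace ℝ (Fin 2)

/-- The set of closest points to `x` on the boundary of `Ω`. -/
def projBd (Ω : Set E2) (x : E2) : Set E2 :=
  {y ∈ frontier Ω | dist x y = infDist x (frontier Ω)}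

/-- The skeleton `Σ(Ω)`: points of `Ω` with more than one closest boundary point. -/
def skeleton (Ω : Set E2) : Set E2 :=
  {x ∈ Ω | ∃ y ∈ projBd Ω x, ∃ z ∈ projBd Ω x, y ≠ z}

/-- The cut locus `Cut(Ω)`: the closure of the skeleton. -/
def cutLocus (Ω : Set E2) : Set E2 := closure (skeleton Ω)

/-- The high ridge `H(Ω)`: the set where `d_{∂Ω}` attains its maximum over `closure Ω`. -/
def highRidge (Ω : Set E2) : Set E2 :=
  {x ∈ closure Ω | ∀ z ∈ closure Ω, infDist z (frontier Ω) ≤ infDist x (frontier Ω)}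

/-- `ρ_Ω`, the maximum of `d_{∂Ω}` over `closure Ω`. -/
def inradius (Ω : Set E2) : ℝ :=
  sSup ((fun z => infDist z (frontier Ω)) '' closure Ω)

/-- A planar domain is of class `C^k` if near each boundary point, in suitable orthonormal
coordinates, its boundary is the graph of a `C^k` function and the domain is the region
above the graph. -/
def IsCkDomain2 (k : ℕ∞) (Ω : Set E2) : Prop :=
  ∀ y ∈ frontier Ω, ∃ (e : E2 ≃ᵃⁱ[ℝ] E2) (U : Set E2) (g : ℝ → ℝ),
    IsOpen U ∧ y ∈ U ∧ ContDiff ℝ k g ∧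
    (∀ z ∈ U, z ∈ Ω ↔ g (e z 0) < e z 1) ∧
    (∀ z ∈ U, z ∈ frontier Ω ↔ g (e z 0) = e z 1)

/-- The standard linear isometry between the Euclidean plane and `ℂ`. -/
def toC : E2 ≃ₗᵢ[ℝ] ℂ := Complex.orthonormalBasisOneI.repr.symm

lemma IsPreconnected.eq_of_forall_int {X : Type*} [TopologicalSpace X] {s : Set X}
    (hs : IsPreconnected s) {f : X → ℝ} (hf : ContinuousOn f s)
    (hint : ∀ x ∈ s, ∃ k : ℤ, f x = k) {x y : X} (hx : x ∈ s) (hy : y ∈ s) : f x = f y :=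
  hs.constant_of_mapsTo (T := range ((↑) : ℤ → ℝ))
    Int.isClosedEmbedding_coe_real.isInducing.isDiscrete_range hf
    (fun z hz => by obtain ⟨k, hk⟩ := hint z hz; exact ⟨k, hk.symm⟩) hx hy

lemma IsPreconnected.eq_of_exp_eq_one {X : Type*} [TopologicalSpace X] {s : Set X}
    (hs : IsPreconnected s) {f : X → ℂ} (hf : ContinuousOn f s)
    (hexp : ∀ x ∈ s, Complex.exp (f x) = 1) {x y : X} (hx : x ∈ s) (hy : y ∈ s) : f x = f y := by
  have key : ∀ z ∈ s, ∃ n : ℤ, f z = n * (2 * π * Complex.I) := fun z hz =>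
    Complex.exp_eq_one_iff.1 (hexp z hz)
  have h := hs.eq_of_forall_int (f := fun z => (f z / (2 * π * Complex.I)).re)
    (Complex.continuous_re.comp_continuousOn (hf.div_const _)) (fun z hz => by
      obtain ⟨n, hn⟩ := key z hz
      refine ⟨n, ?_⟩
      simp only [hn]
      rw [mul_div_cancel_right₀ _ Complex.two_pi_I_ne_zero]
      simp) hx hy
  obtain ⟨n, hn⟩ := key x hx
  obtain ⟨m, hm⟩ := key y hy
  simp only [hn, hm] at h
  rw [mul_div_cancel_right₀ _ Complex.two_pi_I_ne_zero,
    mul_div_cancel_right₀ _ Complex.two_pi_I_ne_zero] at h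
  simp only [Complex.intCast_re, Int.cast_inj] at h
  rw [hn, hm, h]

lemma isSimplyConnected_univ_of_convex {F : Type*} [NormedAddCommGroup F] [NormedSpace ℝ F] :
    IsSimplyConnected (univ : Set F) := by
  have : ContractibleSpace (univ : Set F) := convex_univ.contractibleSpace univ_nonempty
  exact SimplyConnectedSpace.ofContractible _

/-- A nonvanishing continuous function on a real normed space has a continuous logarithm. -/
lemma exists_continuous_exp_eq {F : Type*} [NormedAddCommGroup F] [NormedSpace ℝ F]
    {g : F → ℂ} (hg : Continuous g) (h0 : ∀ x, g x ≠ 0) :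
    ∃ f : F → ℂ, Continuous f ∧ ∀ x, Complex.exp (f x) = g x := by
  obtain ⟨f, hf, hfg⟩ := Complex.exists_continuousOn_eqOn_exp_comp (U := univ)
    isSimplyConnected_univ_of_convex isOpen_univ hg.continuousOn
    (by rintro ⟨x, -, hx⟩; exact h0 x hx)
  exact ⟨f, continuousOn_univ.1 hf, fun x => hfg (mem_univ x)⟩

/-- Exponential polar coordinates about `p`. -/
def expPolar (p : E2) (w : ℂ) : E2 := p + toC.symm (Complex.exp w)

lemma continuous_expPolar (p : E2) : Continuous (expPolar p) := by
  unfold expPolar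
  fun_prop

lemma toC_expPolar_sub (p : E2) (w : ℂ) : toC (expPolar p w - p) = Complex.exp w := by
  simp [expPolar]

lemma norm_expPolar_sub (p : E2) (w : ℂ) : ‖expPolar p w - p‖ = Real.exp w.re := by
  rw [← toC.norm_map, toC_expPolar_sub, Complex.norm_exp]

lemma expPolar_ne (p : E2) (w : ℂ) : expPolar p w ≠ p := by
  intro h
  have := toC_expPolar_sub p w
  rw [h] at this
  simp at this
  exact Complex.exp_ne_zero w this.symm

lemma exists_far_constant {Ω : Set E2} (hbd : Bornology.IsBounded Ω) {τ : E2 → ℝ}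
    (hτ : Continuous τ) (hout : ∀ z ∉ Ω, ∃ k : ℤ, τ z = 2 * k + 1) :
    ∃ c R : ℝ, ∀ z, R < ‖z‖ → z ∉ Ω ∧ τ z = c := by
  obtain ⟨R, hR⟩ := hbd.subset_closedBall 0
  set R' := max R 1
  have hR' : 0 < R' := lt_of_lt_of_le one_pos (le_max_right _ _)
  have hnot : ∀ z, R' < ‖z‖ → z ∉ Ω := fun z hz hzΩ => by
    have := hR hzΩ
    rw [mem_closedBall_zero_iff] at this
    exact absurd (lt_of_le_of_lt (le_max_left _ _) hz) (not_lt.2 this)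
  have hmem : ∀ w ∈ {w : ℂ | Real.log R' < w.re}, R' < ‖expPolar 0 w‖ := fun w hw => by
    have := norm_expPolar_sub 0 w
    rw [sub_zero] at this
    rw [this]
    exact (Real.log_lt_iff_lt_exp hR').1 hw
  have hpre : IsPreconnected {w : ℂ | Real.log R' < w.re} :=
    (convex_halfSpace_re_gt _).isPreconnected
  have hconst : ∀ w ∈ {w : ℂ | Real.log R' < w.re}, ∀ w' ∈ {w : ℂ | Real.log R' < w.re},
      τ (expPolar 0 w) = τ (expPolar 0 w') := by
    intro w hw w' hw'
    have := hpre.eq_of_forall_int (f := fun w => (τ (expPolar 0 w) - 1) / 2)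
      (((hτ.comp (continuous_expPolar 0)).sub continuous_const).div_const 2).continuousOn
      (fun v hv => by
        obtain ⟨k, hk⟩ := hout _ (hnot _ (hmem v hv))
        exact ⟨k, by rw [hk]; ring⟩) hw hw'
    linarith
  have hw0 : ((Real.log R' + 1 : ℝ) : ℂ) ∈ {w : ℂ | Real.log R' < w.re} := by simp
  refine ⟨τ (expPolar 0 ((Real.log R' + 1 : ℝ) : ℂ)), R', fun z hz => ⟨hnot z hz, ?_⟩⟩
  have hz0 : toC z ≠ 0 := by
    rw [← norm_pos_iff, toC.norm_map]
    exact hR'.trans hz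
  have hzw : expPolar 0 (Complex.log (toC z)) = z := by
    simp [expPolar, Complex.exp_log hz0]
  rw [← hzw]
  refine hconst _ ?_ _ hw0
  simp only [mem_ofPred_eq, Complex.log_re, toC.norm_map]
  exact Real.log_lt_log hR' hz

/-- A bounded simply connected open set has no hole: the part `{τ = -1}` of the complement,
isolated by an integer-valued level function `τ`, cannot be bounded. -/
lemma no_bounded_hole {Ω : Set E2} (hop : IsOpen Ω) (hs : IsSimplyConnected Ω) {τ : E2 → ℝ}
    (hτ : Continuous τ) (hin : ∀ z ∈ Ω, |τ z| < 1)
    (hout : ∀ z ∉ Ω, ∃ k : ℤ, τ z = 2 * k + 1) {p : E2} (hp : p ∉ Ω) (hpτ : τ p = -1)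
    {c R : ℝ} (hfar : ∀ z, R < ‖z‖ → z ∉ Ω ∧ τ z = c) (hc : c ≠ -1) : False := by
  classical
  obtain ⟨a, ha, hea⟩ := Complex.exists_continuousOn_eqOn_exp_comp (g := fun z => toC (z - p))
    hs hop (by fun_prop) (by
      rintro ⟨z, hz, h⟩
      have : z = p := by simpa [sub_eq_zero] using h
      exact hp (this ▸ hz))
  set φ : ℝ → ℝ := fun t => max 0 (min 1 (1 / 2 - t)) with hφ
  have hφc : Continuous φ := by fun_prop
  have hφ1 : ∀ t, t < -1 / 2 → φ t = 1 := fun t ht => by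
    simp only [hφ]
    rw [min_eq_left (by linarith), max_eq_right zero_le_one]
  have hφ0 : ∀ t, 1 / 2 < t → φ t = 0 := fun t ht => by
    simp only [hφ]
    exact max_eq_left ((min_le_right _ _).trans (by linarith))
  set G : E2 → ℂ := fun z =>
    if z ∈ Ω then Complex.exp (φ (τ z) * a z) else if τ z = -1 then toC (z - p) else 1 with hG
  have hGin : ∀ z ∈ Ω, G z = Complex.exp (φ (τ z) * a z) := fun z hz => by simp [hG, hz]
  have hodd : ∀ z ∉ Ω, τ z ≠ -1 → 1 ≤ τ z ∨ τ z ≤ -3 := by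
    intro z hz h1
    obtain ⟨k, hk⟩ := hout z hz
    rcases le_or_gt 0 k with h | h
    · left
      have : (0 : ℝ) ≤ k := by exact_mod_cast h
      linarith
    · right
      have h2 : k ≠ -1 := by
        rintro rfl
        apply h1
        rw [hk]
        norm_num
      have : k ≤ -2 := by omega
      have : (k : ℝ) ≤ -2 := by exact_mod_cast this
      linarith
  have hGK : ∀ z, -2 < τ z → τ z < -1 / 2 → G z = toC (z - p) := by
    intro z h1 h2
    by_cases hz : z ∈ Ω
    · rw [hGin z hz, hφ1 _ h2]
      simpa using hea hz
    · have : τ z = -1 := by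
        by_contra h
        rcases hodd z hz h with h | h <;> linarith
      simp [hG, hz, this]
  have hGone : ∀ z, 1 / 2 < τ z ∨ τ z < -2 → G z = 1 := by
    intro z h
    by_cases hz : z ∈ Ω
    · have h1 := abs_lt.1 (hin z hz)
      rcases h with h | h
      · rw [hGin z hz, hφ0 _ h]
        simp
      · linarith
    · have : τ z ≠ -1 := by
        intro h'
        rcases h with h | h <;> linarith
      simp [hG, hz, this]
  have hGc : Continuous G := by
    rw [continuous_iff_continuousAt]
    intro z
    by_cases hz : z ∈ Ω
    · have : ContinuousOn G Ω := by
        refine ContinuousOn.congr (f := fun z => Complex.exp (φ (τ z) * a z)) ?_ hGin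
        exact Complex.continuous_exp.comp_continuousOn
          ((Complex.continuous_ofReal.comp (hφc.comp hτ)).continuousOn.mul ha)
      exact this.continuousAt (hop.mem_nhds hz)
    · by_cases h1 : τ z = -1
      · have hev : G =ᶠ[nhds z] fun z => toC (z - p) := by
          filter_upwards [hτ.continuousAt.eventually (Ioo_mem_nhds (a := -2) (b := -1 / 2)
            (by rw [h1]; norm_num) (by rw [h1]; norm_num))] with x hx
          exact hGK x hx.1 hx.2
        exact ContinuousAt.congr (by fun_prop) hev.symm
      · have hev : G =ᶠ[nhds z] fun _ => 1 := by
          rcases hodd z hz h1 with h | h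
          · filter_upwards [hτ.continuousAt.eventually (Ioi_mem_nhds (a := 1 / 2)
              (by linarith))] with x hx
            exact hGone x (Or.inl hx)
          · filter_upwards [hτ.continuousAt.eventually (Iio_mem_nhds
              (show τ z < -2 by linarith))] with x hx
            exact hGone x (Or.inr hx)
        exact ContinuousAt.congr continuousAt_const hev.symm
  have hG0 : ∀ z, z ≠ p → G z ≠ 0 := by
    intro z hzp
    by_cases hz : z ∈ Ω
    · rw [hGin z hz]
      exact Complex.exp_ne_zero _
    · by_cases h1 : τ z = -1
      · simpa [hG, hz, h1, sub_eq_zero] using hzp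
      · simp [hG, hz, h1]
  obtain ⟨M, hM, hMe⟩ := exists_continuous_exp_eq (g := fun w => G (expPolar p w))
    (hGc.comp (continuous_expPolar p)) (fun w => hG0 _ (expPolar_ne p w))
  have hper : ∀ w, expPolar p (w + 2 * π * Complex.I) = expPolar p w := fun w => by
    simp [expPolar, Complex.exp_add]
  have hD : ∀ w w', M (w + 2 * π * Complex.I) - M w = M (w' + 2 * π * Complex.I) - M w' := by
    intro w w'
    refine (isPreconnected_univ (α := ℂ)).eq_of_exp_eq_one
      (f := fun w => M (w + 2 * π * Complex.I) - M w) (by fun_prop) (fun v _ => ?_)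
      (mem_univ w) (mem_univ w')
    rw [Complex.exp_sub, hMe, hMe, hper, div_self (hG0 _ (expPolar_ne p v))]
  have hre : ∀ w : ℂ, (w + 2 * π * Complex.I).re = w.re := fun w => by simp
  -- near `p`, the increment of `M` over a period is `2πi`
  obtain ⟨δ, hδ, hδ'⟩ := Metric.mem_nhds_iff.1 (hτ.continuousAt.eventually
    (Ioo_mem_nhds (a := -2) (b := -1 / 2) (show -2 < τ p by rw [hpτ]; norm_num)
      (show τ p < -1 / 2 by rw [hpτ]; norm_num)))
  have hnear : ∀ w ∈ {w : ℂ | w.re < Real.log δ}, Complex.exp (M w - w) = 1 := by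
    intro w hw
    have hwp : expPolar p w ∈ ball p δ := by
      rw [mem_ball, dist_eq_norm, norm_expPolar_sub]
      exact (Real.lt_log_iff_exp_lt hδ).1 hw
    have := hδ' hwp
    rw [Complex.exp_sub, hMe, hGK _ this.1 this.2, toC_expPolar_sub,
      div_self (Complex.exp_ne_zero w)]
  have h1 : M (((Real.log δ - 1 : ℝ) : ℂ) + 2 * π * Complex.I) - M ((Real.log δ - 1 : ℝ) : ℂ)
      = 2 * π * Complex.I := by
    have := (convex_halfSpace_re_lt (Real.log δ)).isPreconnected.eq_of_exp_eq_one
      (f := fun w => M w - w) (by fun_prop) hnear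
      (x := ((Real.log δ - 1 : ℝ) : ℂ) + 2 * π * Complex.I)
      (y := ((Real.log δ - 1 : ℝ) : ℂ)) (by rw [mem_ofPred_eq, hre]; simp) (by simp)
    linear_combination this
  -- far from `p`, it vanishes
  set R' := max (R + ‖p‖) 1 with hRdef
  have hR' : 0 < R' := lt_of_lt_of_le one_pos (le_max_right _ _)
  have hfarM : ∀ w ∈ {w : ℂ | Real.log R' < w.re}, Complex.exp (M w) = 1 := by
    intro w hw
    have h2 : R' < ‖expPolar p w - p‖ := by
      rw [norm_expPolar_sub]
      exact (Real.log_lt_iff_lt_exp hR').1 hw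
    have h3 : R < ‖expPolar p w‖ := by
      have := norm_sub_le (expPolar p w) p
      have := le_max_left (R + ‖p‖) 1
      linarith
    obtain ⟨h4, h5⟩ := hfar _ h3
    rw [hMe]
    refine hGone _ ?_
    rcases hodd _ h4 (h5 ▸ hc) with h | h
    · left; linarith
    · right; linarith
  have h2 : M (((Real.log R' + 1 : ℝ) : ℂ) + 2 * π * Complex.I) = M ((Real.log R' + 1 : ℝ) : ℂ) :=
    (convex_halfSpace_re_gt (Real.log R')).isPreconnected.eq_of_exp_eq_one hM.continuousOn hfarM
      (by rw [mem_ofPred_eq, hre]; simp) (by simp)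
  have h3 := hD ((Real.log δ - 1 : ℝ) : ℂ) ((Real.log R' + 1 : ℝ) : ℂ)
  rw [h1, h2, sub_self] at h3
  exact Complex.two_pi_I_ne_zero h3

/-- In the complement of a bounded simply connected open set, a level function that is odd integer
valued off the set and of modulus less than one inside cannot take both values `1` and `-1`. -/
lemma no_two_sides {Ω : Set E2} (hop : IsOpen Ω) (hbd : Bornology.IsBounded Ω)
    (hs : IsSimplyConnected Ω) {τ : E2 → ℝ}
    (hτ : Continuous τ) (hin : ∀ z ∈ Ω, |τ z| < 1)
    (hout : ∀ z ∉ Ω, ∃ k : ℤ, τ z = 2 * k + 1) {p q : E2} (hp : p ∉ Ω) (hpτ : τ p = -1)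
    (hq : q ∉ Ω) (hqτ : τ q = 1) : False := by
  obtain ⟨c, R, hfar⟩ := exists_far_constant hbd hτ hout
  by_cases hc : c = -1
  · refine no_bounded_hole hop hs (τ := fun z => - τ z) (p := q) (c := -c) (R := R) (by fun_prop)
      (fun z hz => by rw [abs_neg]; exact hin z hz) (fun z hz => ?_) hq (by rw [hqτ])
      (fun z hz => ⟨(hfar z hz).1, by rw [(hfar z hz).2]⟩) (by rw [hc]; norm_num)
    obtain ⟨k, hk⟩ := hout z hz
    exact ⟨-k - 1, by rw [hk]; push_cast; ring⟩
  · exact no_bounded_hole hop hs hτ hin hout hp hpτ hfar hc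

/-- A function that can be computed from any closest point of a compact set is continuous. -/
lemma continuousAt_of_closest_point {Y : Type*} [TopologicalSpace Y] {Γ : Set E2}
    (hΓ : IsCompact Γ) (hne : Γ.Nonempty) {f : E2 → Y} {F : E2 × E2 → Y} {z₀ : E2}
    (hf : ∀ᶠ z in nhds z₀, ∀ y ∈ Γ, dist z y = infDist z Γ → f z = F (z, y))
    (hF : ∀ y ∈ Γ, dist z₀ y = infDist z₀ Γ → ContinuousAt F (z₀, y)) : ContinuousAt f z₀ := by
  choose P hPm hP using fun z => hΓ.exists_infDist_eq_dist hne z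
  rw [ContinuousAt, Filter.tendsto_iff_ultrafilter]
  intro g hg
  obtain ⟨y, hy, hgy⟩ := hΓ.ultrafilter_le_nhds (g.map P) (by
    rw [Filter.le_principal_iff]
    exact show P ⁻¹' Γ ∈ g from Filter.univ_mem' hPm)
  have hPy : Filter.Tendsto P g (nhds y) := hgy
  have hid : Filter.Tendsto (fun z => z) g (nhds z₀) := hg
  have hdist : dist z₀ y = infDist z₀ Γ := by
    refine tendsto_nhds_unique (hid.dist hPy) ?_
    simp_rw [← hP]
    exact ((continuous_infDist_pt Γ).tendsto z₀).mono_left hg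
  have h1 : Filter.Tendsto (fun z => F (z, P z)) g (nhds (F (z₀, y))) :=
    (hF y hy hdist).tendsto.comp (hid.prodMk_nhds hPy)
  rw [hf.self_of_nhds y hy hdist]
  refine h1.congr' ?_
  filter_upwards [hg hf] with z hz
  exact (hz _ (hPm z) (hP z).symm).symm

lemma infDist_compl_eq_infDist_frontier {Ω : Set E2} (hop : IsOpen Ω) (hne : Ω ≠ univ) {z : E2}
    (hz : z ∈ Ω) : infDist z Ωᶜ = infDist z (frontier Ω) := by
  obtain ⟨y, hy, h⟩ := exists_mem_frontier_infDist_compl_eq_dist hz hne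
  refine le_antisymm ?_ (h ▸ infDist_le_dist_of_mem hy)
  refine infDist_le_infDist_of_subset (fun x hx => ?_) ⟨y, hy⟩
  rw [hop.frontier_eq] at hx
  exact hx.2

/-- A bounded simply connected planar open set cannot be two-sided about its high ridge, i.e. all
points of the high ridge having exactly two, mutually antipodal, closest boundary points. -/
lemma not_two_sided {Ω : Set E2} (hop : IsOpen Ω) (hbd : Bornology.IsBounded Ω)
    (hs : IsSimplyConnected Ω) {ρ : ℝ} (hρ : 0 < ρ)
    (hle : ∀ z ∈ Ω, infDist z (frontier Ω) ≤ ρ)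
    (huniq : ∀ z ∈ Ω, infDist z (frontier Ω) < ρ → ∀ y ∈ projBd Ω z, ∀ y' ∈ projBd Ω z, y = y')
    (hanti : ∀ z ∈ Ω, infDist z (frontier Ω) = ρ → ∀ y ∈ projBd Ω z, ∀ y' ∈ projBd Ω z,
      y' - z = y - z ∨ y' - z = -(y - z))
    {x₀ u : E2} (hx₀ : x₀ ∈ Ω) (hx₀d : infDist x₀ (frontier Ω) = ρ)
    (hu : x₀ + u ∈ projBd Ω x₀) (hu' : x₀ - u ∈ projBd Ω x₀) : False := by
  classical
  have hΓ : IsCompact (frontier Ω) := hbd.isCompact_closure.of_isClosed_subset isClosed_frontier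
    frontier_subset_closure
  have hΓne : (frontier Ω).Nonempty := ⟨_, hu.1⟩
  have hdisj : ∀ y ∈ frontier Ω, y ∉ Ω := fun y hy => by
    rw [hop.frontier_eq] at hy
    exact hy.2
  have hnu : Ω ≠ univ := fun h => hdisj _ hu.1 (h ▸ mem_univ _)
  have hcn : (Ωᶜ).Nonempty := nonempty_compl.2 hnu
  have hpre : IsPreconnected Ω := hs.isPathConnected.isConnected.isPreconnected
  choose P hPm hP using fun z => hΓ.exists_infDist_eq_dist hΓne z
  set D : E2 → ℝ := fun z => infDist z Ωᶜ with hDdef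
  have hDc : Continuous D := continuous_infDist_pt _
  have hDin : ∀ z ∈ Ω, D z = infDist z (frontier Ω) := fun z hz =>
    infDist_compl_eq_infDist_frontier hop hnu hz
  have hDout : ∀ z ∉ Ω, D z = 0 := fun z hz => infDist_zero_of_mem hz
  have hDpos : ∀ z ∈ Ω, 0 < D z := fun z hz =>
    (hop.isClosed_compl.notMem_iff_infDist_pos hcn).1 (not_not.2 hz)
  have hne : ∀ z ∈ Ω, ∀ y ∈ frontier Ω, z - y ≠ 0 := fun z hz y hy h =>
    hdisj y hy (sub_eq_zero.1 h ▸ hz)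
  -- the square of the unit normal
  set N : E2 × E2 → ℂ := fun v => (toC (v.1 - v.2) / ‖v.1 - v.2‖) ^ 2 with hN
  have hNc : ∀ z ∈ Ω, ∀ y ∈ frontier Ω, ContinuousAt N (z, y) := fun z hz y hy => by
    have h1 : ContinuousAt (fun v : E2 × E2 => toC (v.1 - v.2)) (z, y) := by fun_prop
    have h2 : ContinuousAt (fun v : E2 × E2 => ((‖v.1 - v.2‖ : ℝ) : ℂ)) (z, y) := by fun_prop
    exact (h1.div h2 (by simpa using hne z hz y hy)).pow 2
  have hNP : ∀ z ∈ Ω, ∀ y ∈ frontier Ω, dist z y = infDist z (frontier Ω) →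
      N (z, P z) = N (z, y) := by
    intro z hz y hy hyd
    rcases (hle z hz).lt_or_eq with h | h
    · rw [huniq z hz h _ ⟨hPm z, (hP z).symm⟩ _ ⟨hy, hyd⟩]
    · have h1 : z - P z = z - y ∨ z - P z = -(z - y) := by
        rcases hanti z hz h _ ⟨hy, hyd⟩ _ ⟨hPm z, (hP z).symm⟩ with h | h
        · left
          rw [← neg_sub, h, neg_sub]
        · right
          rw [← neg_sub, h]
          simp
      simp only [hN]
      rcases h1 with h | h
      · rw [h]
      · rw [h, map_neg, norm_neg, neg_div, neg_sq]
  have hN0 : ∀ z ∈ Ω, ∀ y ∈ frontier Ω, N (z, y) ≠ 0 := fun z hz y hy => by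
    simp only [hN]
    refine pow_ne_zero _ (div_ne_zero ?_ ?_)
    · exact (map_ne_zero_iff toC toC.injective).2 (hne z hz y hy)
    · simpa using hne z hz y hy
  obtain ⟨n, hnc, hn2⟩ := Complex.exists_continuousOn_pow_eq (g := fun z => N (z, P z)) hs hop
    (fun z hz => by
      refine ContinuousAt.continuousWithinAt
        (continuousAt_of_closest_point hΓ hΓne (F := N) ?_ (fun y hy _ => hNc z hz y hy))
      filter_upwards [hop.mem_nhds hz] with w hw y hy hyd
      exact hNP w hw y hy hyd)
    (by
      rintro ⟨z, hz, h⟩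
      exact hN0 z hz _ (hPm z) h) two_ne_zero
  have hn0 : ∀ z ∈ Ω, n z ≠ 0 := fun z hz h => by
    have := hn2 z
    rw [h] at this
    exact hN0 z hz _ (hPm z) (by rw [← this]; simp)
  -- the side of the ridge on which a point lies
  set E : E2 × E2 → ℝ := fun v => (toC (v.2 - v.1) / ‖v.2 - v.1‖ / n v.1).re with hE
  have hE1 : ∀ z ∈ Ω, ∀ y ∈ frontier Ω, dist z y = infDist z (frontier Ω) →
      E (z, y) = 1 ∨ E (z, y) = -1 := by
    intro z hz y hy hyd
    have h1 : (toC (y - z) / ‖y - z‖) ^ 2 = n z ^ 2 := by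
      rw [hn2, hNP z hz y hy hyd]
      simp only [hN]
      rw [← neg_sub y z, map_neg, norm_neg, neg_div, neg_sq]
    rcases sq_eq_sq_iff_eq_or_eq_neg.1 h1 with h | h
    · left
      simp only [hE]
      rw [h, div_self (hn0 z hz), Complex.one_re]
    · right
      simp only [hE]
      rw [h, neg_div, div_self (hn0 z hz), Complex.neg_re, Complex.one_re]
  set ε : E2 → ℝ := fun z => if z ∈ Ω then E (z, P z) else 1 with hε
  have hεin : ∀ z ∈ Ω, ε z = E (z, P z) := fun z hz => by simp [hε, hz]
  have hε1 : ∀ z, ε z = 1 ∨ ε z = -1 := fun z => by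
    by_cases hz : z ∈ Ω
    · rw [hεin z hz]
      exact hE1 z hz _ (hPm z) (hP z).symm
    · left
      simp [hε, hz]
  have hεsq : ∀ z, ε z ^ 2 = 1 := fun z => by
    rcases hε1 z with h | h <;> rw [h] <;> norm_num
  have hqc : Continuous fun z => ε z * Real.sin (π * (D z / ρ)) := by
    rw [continuous_iff_continuousAt]
    intro z
    by_cases hz : z ∈ Ω
    · refine continuousAt_of_closest_point hΓ hΓne
        (F := fun v => E v * Real.sin (π * (D v.1 / ρ))) ?_ ?_
      · filter_upwards [hop.mem_nhds hz] with w hw y hy hyd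
        rcases (hle w hw).lt_or_eq with h | h
        · rw [hεin w hw, huniq w hw h _ ⟨hPm w, (hP w).symm⟩ _ ⟨hy, hyd⟩]
        · rw [hDin w hw, h, div_self hρ.ne', mul_one, Real.sin_pi, mul_zero, mul_zero]
      · intro y hy _
        have h1 : ContinuousAt (fun v : E2 × E2 => toC (v.2 - v.1)) (z, y) := by fun_prop
        have h2 : ContinuousAt (fun v : E2 × E2 => ((‖v.2 - v.1‖ : ℝ) : ℂ)) (z, y) := by fun_prop
        have h3 : ContinuousAt (fun v : E2 × E2 => n v.1) (z, y) :=
          ContinuousAt.comp (f := Prod.fst) (g := n) (hnc.continuousAt (hop.mem_nhds hz))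
            continuousAt_fst
        have h4 : ContinuousAt E (z, y) := Complex.continuous_re.continuousAt.comp
          ((h1.div h2 (by simpa [norm_sub_rev] using hne z hz y hy)).div h3 (hn0 z hz))
        exact h4.mul (by fun_prop)
    · rw [ContinuousAt, hDout z hz]
      simp only [zero_div, mul_zero, Real.sin_zero]
      refine squeeze_zero_norm (a := fun w => |Real.sin (π * (D w / ρ))|) (fun w => ?_) ?_
      · rw [Real.norm_eq_abs, abs_mul]
        rcases hε1 w with h | h <;> rw [h] <;> simp
      · have : Continuous fun w => |Real.sin (π * (D w / ρ))| := by fun_prop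
        convert this.tendsto z using 2
        simp [hDout z hz]
  set F : E2 → ℂ := fun z => -(Real.cos (π * (D z / ρ)) : ℂ) +
    ((ε z * Real.sin (π * (D z / ρ)) : ℝ) : ℂ) * Complex.I with hF
  have hFc : Continuous F := by
    have h1 : Continuous fun z => ((ε z * Real.sin (π * (D z / ρ)) : ℝ) : ℂ) :=
      Complex.continuous_ofReal.comp hqc
    have h2 : Continuous fun z => (Real.cos (π * (D z / ρ)) : ℂ) := by fun_prop
    exact h2.neg.add (h1.mul continuous_const)
  have hFre : ∀ z, (F z).re = -Real.cos (π * (D z / ρ)) := fun z => by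
    simp only [hF, Complex.add_re, Complex.neg_re, Complex.re_ofReal_mul, Complex.I_re,
      Complex.ofReal_re, mul_zero, add_zero]
  have hFim : ∀ z, (F z).im = ε z * Real.sin (π * (D z / ρ)) := fun z => by
    simp only [hF, Complex.add_im, Complex.neg_im, Complex.im_ofReal_mul, Complex.I_im,
      Complex.ofReal_im, mul_one, neg_zero, zero_add]
  have hFn : ∀ z, ‖F z‖ = 1 := fun z => by
    rw [← sq_eq_sq₀ (norm_nonneg _) zero_le_one, Complex.sq_norm, Complex.normSq_apply, hFre, hFim]
    nlinarith [Real.sin_sq_add_cos_sq (π * (D z / ρ)), hεsq z]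
  obtain ⟨T, hTc, hT⟩ := exists_continuous_exp_eq hFc (fun z h => by
    have := hFn z
    rw [h] at this
    simp at this)
  have hTre : ∀ z, (T z).re = 0 := fun z => by
    have := hFn z
    rwa [← hT, Complex.norm_exp, Real.exp_eq_one_iff] at this
  set θ : E2 → ℝ := fun z => (T z).im with hθ
  have hθc : Continuous θ := Complex.continuous_im.comp hTc
  have hTθ : ∀ z, T z = θ z * Complex.I := fun z => by
    apply Complex.ext
    · simp [hTre]
    · simp [hθ]
  have hcos : ∀ z, Real.cos (θ z) = -Real.cos (π * (D z / ρ)) := fun z => by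
    rw [← hFre, ← hT, hTθ, Complex.exp_ofReal_mul_I_re]
  have hDx₀ : D x₀ = ρ := by rw [hDin x₀ hx₀, hx₀d]
  obtain ⟨k, hk⟩ : ∃ k : ℤ, (k : ℝ) * (2 * π) = θ x₀ := by
    rw [← Real.cos_eq_one_iff, hcos, hDx₀, div_self hρ.ne', mul_one, Real.cos_pi, neg_neg]
  have hπ := Real.pi_pos
  set τ : E2 → ℝ := fun z => θ z / π - 2 * k with hτ
  have hτc : Continuous τ := by fun_prop
  have hθτ : ∀ z, θ z = τ z * π + k * (2 * π) := fun z => by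
    simp only [hτ]
    field_simp
    ring
  have hcosτ : ∀ z, Real.cos (τ z * π) = -Real.cos (π * (D z / ρ)) := fun z => by
    rw [← hcos, hθτ, Real.cos_add_int_mul_two_pi]
  have hτ0 : τ x₀ = 0 := by
    simp only [hτ]
    rw [← hk]
    field_simp
    ring
  have hτne : ∀ z ∈ Ω, Real.cos (τ z * π) ≠ -1 := by
    intro z hz h
    rw [hcosτ, neg_inj] at h
    have h1 := hDpos z hz
    have h2 := hle z hz
    rw [← hDin z hz] at h2
    have h3 : D z / ρ ≤ 1 := (div_le_one hρ).2 h2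
    have h4 : 0 < D z / ρ := div_pos h1 hρ
    have h5 := (Real.cos_eq_one_iff_of_lt_of_lt (by nlinarith) (by nlinarith)).1 h
    have := mul_pos hπ h4
    linarith
  have hin : ∀ z ∈ Ω, |τ z| < 1 := by
    intro z hz
    rw [abs_lt]
    constructor
    · by_contra! h
      obtain ⟨w, hw, hw1⟩ := hpre.intermediate_value hz hx₀ hτc.continuousOn
        (show (-1 : ℝ) ∈ Icc (τ z) (τ x₀) from ⟨h, by rw [hτ0]; norm_num⟩)
      exact hτne w hw (by rw [hw1]; simp)
    · by_contra! h
      obtain ⟨w, hw, hw1⟩ := hpre.intermediate_value hx₀ hz hτc.continuousOn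
        (show (1 : ℝ) ∈ Icc (τ x₀) (τ z) from ⟨by rw [hτ0]; norm_num, h⟩)
      exact hτne w hw (by rw [hw1]; simp)
  have hout : ∀ z ∉ Ω, ∃ j : ℤ, τ z = 2 * j + 1 := by
    intro z hz
    have h1 := hcosτ z
    rw [hDout z hz, zero_div, mul_zero, Real.cos_zero] at h1
    have h2 : Real.cos (τ z * π - π) = 1 := by rw [Real.cos_sub_pi, h1, neg_neg]
    obtain ⟨j, hj⟩ := (Real.cos_eq_one_iff _).1 h2
    refine ⟨j, ?_⟩
    have h3 : (τ z - (2 * j + 1)) * π = 0 := by linarith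
    rcases mul_eq_zero.1 h3 with h | h
    · linarith
    · exact absurd h hπ.ne'
  -- along the segment joining the two antipodal boundary points, `τ` is affine
  have hun : ‖u‖ = ρ := by
    have := hu.2
    rw [hx₀d, dist_eq_norm] at this
    simpa using this
  have hu0 : u ≠ 0 := by
    rw [← norm_pos_iff, hun]
    exact hρ
  set L : ℝ → E2 := fun s => x₀ + s • u with hL
  have hLc : Continuous L := by fun_prop
  have hLd : ∀ s ∈ Icc (0 : ℝ) 1, ∀ v : E2, ‖v‖ = ρ → x₀ + v ∈ frontier Ω →
      dist (x₀ + s • v) (x₀ + v) = ρ * (1 - s) ∧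
      infDist (x₀ + s • v) (frontier Ω) = ρ * (1 - s) := by
    intro s hs v hv hvf
    have h1 : dist (x₀ + s • v) (x₀ + v) = ρ * (1 - s) := by
      rw [dist_add_left, dist_comm, dist_eq_norm]
      have : v - s • v = (1 - s) • v := by rw [sub_smul, one_smul]
      rw [this, norm_smul, hv, Real.norm_of_nonneg (by linarith [hs.2]), mul_comm]
    refine ⟨h1, le_antisymm (h1 ▸ infDist_le_dist_of_mem hvf) ?_⟩
    have h2 : infDist x₀ (frontier Ω) ≤ infDist (x₀ + s • v) (frontier Ω) + dist x₀ (x₀ + s • v) :=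
      infDist_le_infDist_add_dist
    rw [hx₀d, dist_self_add_right, norm_smul, hv, Real.norm_of_nonneg hs.1] at h2
    linarith
  have hball : ball x₀ ρ ⊆ Ω := by
    have := ball_infDist_compl_subset (x := x₀) (s := Ω)
    rwa [show infDist x₀ Ωᶜ = ρ from hDx₀] at this
  have hLin : ∀ s ∈ Ioo (-1 : ℝ) 1, L s ∈ Ω := fun s hs => by
    apply hball
    rw [mem_ball, dist_self_add_left, norm_smul, hun, Real.norm_eq_abs]
    have := abs_lt.2 hs
    nlinarith
  have hu'' : x₀ + -u ∈ frontier Ω := by rw [← sub_eq_add_neg]; exact hu'.1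
  have hLD : ∀ s ∈ Ioo (-1 : ℝ) 1, (0 ≤ s → dist (L s) (x₀ + u) = infDist (L s) (frontier Ω) ∧
      infDist (L s) (frontier Ω) = ρ * (1 - s)) ∧
      (s ≤ 0 → dist (L s) (x₀ + -u) = infDist (L s) (frontier Ω) ∧
      infDist (L s) (frontier Ω) = ρ * (1 + s)) := by
    intro s hs
    constructor
    · intro h
      have := hLd s ⟨h, hs.2.le⟩ u hun hu.1
      exact ⟨this.1.trans this.2.symm, this.2⟩
    · intro h
      have := hLd (-s) ⟨by linarith, by linarith [hs.1]⟩ (-u) (by rw [norm_neg, hun]) hu''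
      simp only [smul_neg, neg_smul, neg_neg, sub_neg_eq_add] at this
      exact ⟨this.1.trans this.2.symm, this.2⟩
  have hC0 : toC u / (ρ : ℂ) ≠ 0 := div_ne_zero (by simpa using hu0) (by exact_mod_cast hρ.ne')
  have hEu : ∀ s ∈ Ioo (-1 : ℝ) 1, toC (x₀ + u - L s) / ‖x₀ + u - L s‖ = toC u / (ρ : ℂ) ∧
      toC (x₀ + -u - L s) / ‖x₀ + -u - L s‖ = -(toC u / (ρ : ℂ)) := by
    intro s hs
    have h1 : x₀ + u - L s = (1 - s) • u := by
      simp only [hL]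
      module
    have h2 : x₀ + -u - L s = -((1 + s) • u) := by
      simp only [hL]
      module
    have h3 : ((1 - s : ℝ) : ℂ) ≠ 0 := by exact_mod_cast (sub_pos.2 hs.2).ne'
    have h4 : ((1 + s : ℝ) : ℂ) ≠ 0 := by
      have : 0 < 1 + s := by linarith [hs.1]
      exact_mod_cast this.ne'
    rw [h1, h2, map_neg, norm_neg, norm_smul, norm_smul, hun, map_smul, map_smul,
      Real.norm_of_nonneg (by linarith [hs.2]), Real.norm_of_nonneg (by linarith [hs.1]),
      Complex.ofReal_mul, Complex.ofReal_mul, Complex.real_smul, Complex.real_smul, neg_div,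
      mul_div_mul_left _ _ h3, mul_div_mul_left _ _ h4]
    exact ⟨rfl, rfl⟩
  have hsq : EqOn ((fun s => n (L s)) ^ 2) ((fun _ => toC u / (ρ : ℂ)) ^ 2) (Ioo (-1 : ℝ) 1) := by
    intro s hs
    simp only [Pi.pow_apply]
    rw [hn2]
    rcases le_total 0 s with h | h
    · rw [hNP _ (hLin s hs) _ hu.1 ((hLD s hs).1 h).1, ← (hEu s hs).1]
      simp only [hN]
      rw [← neg_sub, map_neg, norm_neg, neg_div, neg_sq]
    · rw [hNP _ (hLin s hs) _ hu'' ((hLD s hs).2 h).1, ← neg_sq (toC u / (ρ : ℂ)), ← (hEu s hs).2]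
      simp only [hN]
      rw [← neg_sub, map_neg, norm_neg, neg_div, neg_sq]
  obtain ⟨e, he1, he⟩ : ∃ e : ℝ, (e = 1 ∨ e = -1) ∧
      ∀ s ∈ Ioo (-1 : ℝ) 1, n (L s) = e * (toC u / (ρ : ℂ)) := by
    rcases isPreconnected_Ioo.eq_or_eq_neg_of_sq_eq (hnc.comp hLc.continuousOn hLin)
      continuousOn_const hsq (fun _ => hC0) with h | h
    · exact ⟨1, Or.inl rfl, fun s hs => by simpa using h hs⟩
    · exact ⟨-1, Or.inr rfl, fun s hs => by simpa using h hs⟩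
  have hediv : ∀ c : ℂ, c ≠ 0 → (c / (e * c)).re = e := fun c hc => by
    rcases he1 with h | h <;> simp [h, hc]
  have hFL : ∀ s ∈ Icc (-1 : ℝ) 1, Complex.exp (T (L s) - (e * s * π : ℝ) * Complex.I) = 1 := by
    intro s hs
    rw [Complex.exp_sub, div_eq_one_iff_eq (Complex.exp_ne_zero _), hT]
    by_cases hs1 : s ∈ Ioo (-1 : ℝ) 1
    · have hz := hLin s hs1
      apply Complex.ext
      · rw [hFre, Complex.exp_ofReal_mul_I_re, hDin _ hz, ← Real.cos_pi_sub]
        rcases le_total 0 s with h | h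
        · rw [((hLD s hs1).1 h).2, mul_div_cancel_left₀ _ hρ.ne']
          rcases he1 with h | h <;> rw [h]
          · congr 1; ring
          · rw [← Real.cos_neg]; congr 1; ring
        · rw [((hLD s hs1).2 h).2, mul_div_cancel_left₀ _ hρ.ne']
          rcases he1 with h | h <;> rw [h]
          · rw [← Real.cos_neg]; congr 1; ring
          · congr 1; ring
      · rw [hFim, Complex.exp_ofReal_mul_I_im, hDin _ hz, hεin _ hz]
        rcases lt_trichotomy 0 s with h | h | h
        · have h1 := (hLD s hs1).1 h.le
          have h2 : P (L s) = x₀ + u := huniq _ hz (by rw [h1.2]; nlinarith) _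
            ⟨hPm _, (hP _).symm⟩ _ ⟨hu.1, h1.1⟩
          rw [h1.2, mul_div_cancel_left₀ _ hρ.ne', h2]
          simp only [hE]
          rw [(hEu s hs1).1, he s hs1, hediv _ hC0, mul_sub, mul_one, Real.sin_pi_sub]
          rcases he1 with h | h <;> rw [h] <;> simp [mul_comm]
        · subst h
          simp [hL, hx₀d, hρ.ne']
        · have h1 := (hLD s hs1).2 h.le
          have h2 : P (L s) = x₀ + -u := huniq _ hz (by rw [h1.2]; nlinarith) _
            ⟨hPm _, (hP _).symm⟩ _ ⟨hu'', h1.1⟩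
          rw [h1.2, mul_div_cancel_left₀ _ hρ.ne', h2]
          simp only [hE]
          rw [(hEu s hs1).2, he s hs1, neg_div, Complex.neg_re, hediv _ hC0, mul_add, mul_one,
            add_comm π, Real.sin_add_pi]
          rcases he1 with h | h <;> rw [h] <;> simp [mul_comm]
    · have hz : L s ∉ Ω ∧ (s = 1 ∨ s = -1) := by
        rcases hs.2.lt_or_eq with h | h
        · have : s = -1 := by
            by_contra h'
            exact hs1 ⟨lt_of_le_of_ne hs.1 (Ne.symm h'), h⟩
          refine ⟨?_, Or.inr this⟩
          simpa [hL, this] using hdisj _ hu''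
        · refine ⟨?_, Or.inl h⟩
          simpa [hL, h] using hdisj _ hu.1
      apply Complex.ext
      · rw [hFre, Complex.exp_ofReal_mul_I_re, hDout _ hz.1]
        rcases he1 with h | h <;> rcases hz.2 with h' | h' <;> rw [h, h'] <;> simp
      · rw [hFim, Complex.exp_ofReal_mul_I_im, hDout _ hz.1]
        rcases he1 with h | h <;> rcases hz.2 with h' | h' <;> rw [h, h'] <;> simp
  have haff : ∀ s ∈ Icc (-1 : ℝ) 1, τ (L s) = e * s := by
    intro s hs
    have h1 := isPreconnected_Icc.eq_of_exp_eq_one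
      (f := fun s => T (L s) - (e * s * π : ℝ) * Complex.I)
      (by fun_prop) hFL hs (show (0 : ℝ) ∈ Icc (-1 : ℝ) 1 by constructor <;> norm_num)
    have h2 := congrArg Complex.im h1
    simp only [hTθ] at h2
    simp [hL] at h2
    simp only [hL, hτ]
    rw [← hk] at h2
    field_simp
    linarith
  have h1 := haff 1 (by constructor <;> norm_num)
  have h2 := haff (-1) (by constructor <;> norm_num)
  have hL1 : L 1 ∉ Ω := by simpa [hL] using hdisj _ hu.1
  have hL2 : L (-1) ∉ Ω := by simpa [hL] using hdisj _ hu''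
  rcases he1 with h | h
  · exact no_two_sides hop hbd hs hτc hin hout hL2 (by rw [h2, h]; norm_num) hL1
      (by rw [h1, h]; norm_num)
  · exact no_two_sides hop hbd hs hτc hin hout hL1 (by rw [h1, h]; norm_num) hL2
      (by rw [h2, h]; norm_num)

lemma tendsto_closest_point {Γ : Set E2} (hΓ : IsCompact Γ) {P : E2 → E2} (hPm : ∀ z, P z ∈ Γ)
    (hP : ∀ z, infDist z Γ = dist z (P z)) {w y : E2}
    (huniq : ∀ y' ∈ Γ, dist w y' = infDist w Γ → y' = y) :
    Filter.Tendsto P (nhds w) (nhds y) := by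
  refine hΓ.tendsto_nhds_of_unique_mapClusterPt (Filter.Eventually.of_forall hPm) fun y' hy' h => ?_
  refine huniq y' hy' ?_
  obtain ⟨g, hg, hgP⟩ := mapClusterPt_iff_ultrafilter.1 h
  have hid : Filter.Tendsto (fun z => z) g (nhds w) := hg
  refine tendsto_nhds_unique (hid.dist hgP) ?_
  simp_rw [← hP]
  exact ((continuous_infDist_pt Γ).tendsto w).mono_left hg

/-- Away from a set with a unique closest point, the distance to the set has slope one. -/
lemma eventually_lt_infDist_of_unique {Γ : Set E2} (hΓ : IsCompact Γ) {w y : E2} (hw : w ∉ Γ)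
    (hy : y ∈ Γ) (huniq : ∀ y' ∈ Γ, dist w y' = infDist w Γ → y' = y) {c : ℝ} (hc : c < 1) :
    ∀ᶠ ε in nhdsWithin (0 : ℝ) (Ioi 0),
      infDist w Γ + c * ‖ε • (w - y)‖ < infDist (w + ε • (w - y)) Γ := by
  choose P hPm hP using fun z => hΓ.exists_infDist_eq_dist ⟨y, hy⟩ z
  have hpos : ∀ p ∈ Γ, 0 < ‖w - p‖ := fun p hp =>
    norm_pos_iff.2 (sub_ne_zero.2 fun h => hw (h ▸ hp))
  have hv := hpos y hy
  have hL : Filter.Tendsto (fun ε : ℝ => w + ε • (w - y)) (nhdsWithin 0 (Ioi 0)) (nhds w) := by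
    have : Continuous fun ε : ℝ => w + ε • (w - y) := by fun_prop
    simpa using (this.tendsto 0).mono_left nhdsWithin_le_nhds
  have hQ := (tendsto_closest_point hΓ hPm hP huniq).comp hL
  have hcl : ∀ᶠ p in nhds y, c * ‖w - y‖ * ‖w - p‖ < inner ℝ (w - p) (w - y) := by
    refine ContinuousAt.eventually_lt (by fun_prop) (by fun_prop) ?_
    rw [real_inner_self_eq_norm_mul_norm]
    nlinarith [mul_pos hv hv]
  filter_upwards [hQ.eventually hcl, self_mem_nhdsWithin] with ε h1 hε
  rw [mem_Ioi] at hε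
  simp only [Function.comp_apply] at h1
  rw [hP (w + ε • (w - y)), dist_eq_norm, norm_smul, Real.norm_of_nonneg hε.le]
  set p := P (w + ε • (w - y)) with hp
  have h2 : infDist w Γ ≤ ‖w - p‖ := dist_eq_norm w p ▸ infDist_le_dist_of_mem (hPm _)
  have h3 := real_inner_le_norm (w - p) (w + ε • (w - y) - p)
  have h4 : w + ε • (w - y) - p = (w - p) + ε • (w - y) := by abel
  rw [h4, inner_add_right, inner_smul_right, real_inner_self_eq_norm_mul_norm] at h3
  rw [h4]
  have h5 := hpos p (hPm _)
  by_contra! h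
  have h6 : ‖w - p‖ * ‖w - p + ε • (w - y)‖ ≤ ‖w - p‖ * (‖w - p‖ + c * (ε * ‖w - y‖)) :=
    mul_le_mul_of_nonneg_left (by linarith) h5.le
  nlinarith [mul_lt_mul_of_pos_left h1 hε]

/-- If the skeleton lies in the high ridge, the boundary distance decreases with slope one away
from the high ridge. -/
lemma infDist_highRidge_le {Ω : Set E2} (hop : IsOpen Ω) (hbd : Bornology.IsBounded Ω)
    (hsk : skeleton Ω ⊆ highRidge Ω) {x₀ : E2} (hx₀ : x₀ ∈ highRidge Ω) {z : E2}
    (hz : z ∈ closure Ω) :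
    infDist z (highRidge Ω) ≤ infDist x₀ (frontier Ω) - infDist z (frontier Ω) := by
  have hK := hbd.isCompact_closure
  have hΓ : IsCompact (frontier Ω) := hK.of_isClosed_subset isClosed_frontier
    frontier_subset_closure
  refine le_on_closure (s := Ω) (f := fun z => infDist z (highRidge Ω))
    (g := fun z => infDist x₀ (frontier Ω) - infDist z (frontier Ω)) (fun z hz => ?_)
    (continuous_infDist_pt _).continuousOn
    (continuous_const.sub (continuous_infDist_pt _)).continuousOn hz
  have hdisj : ∀ y ∈ frontier Ω, y ∉ Ω := fun y hy => by
    rw [hop.frontier_eq] at hy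
    exact hy.2
  have hzcl := subset_closure hz
  have hΓne : (frontier Ω).Nonempty := by
    rw [nonempty_iff_ne_empty]
    intro h
    rcases isClopen_iff.1 (isClopen_iff_frontier_eq_empty.2 h) with h | h
    · simp [h] at hz
    · rw [h] at hbd
      exact NormedSpace.unbounded_univ ℝ E2 hbd
  have hzpos : 0 < infDist z (frontier Ω) :=
    (isClosed_frontier.notMem_iff_infDist_pos hΓne).1 fun h => hdisj z h hz
  have key : ∀ c : ℝ, 0 < c → c < 1 →
      c * infDist z (highRidge Ω) ≤ infDist x₀ (frontier Ω) - infDist z (frontier Ω) := by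
    intro c hc0 hc1
    obtain ⟨w, hw, hmax⟩ := hK.exists_isMaxOn ⟨z, hzcl⟩
      (f := fun w => infDist w (frontier Ω) - c * dist w z)
      ((continuous_infDist_pt _).sub (by fun_prop)).continuousOn
    have hzw := hmax hzcl
    simp only [mem_ofPred_eq, dist_self, mul_zero, sub_zero] at hzw
    have hwpos : 0 < infDist w (frontier Ω) := by
      have := mul_nonneg hc0.le (dist_nonneg (x := w) (y := z))
      linarith
    have hwf := (isClosed_frontier.notMem_iff_infDist_pos hΓne).2 hwpos
    have hwΩ : w ∈ Ω := by
      by_contra h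
      exact hwf (by rw [hop.frontier_eq]; exact ⟨hw, h⟩)
    by_cases hwH : w ∈ highRidge Ω
    · have h1 := infDist_le_dist_of_mem hwH (x := z)
      have h2 := hx₀.2 w hw
      rw [dist_comm] at h1
      nlinarith
    · exfalso
      obtain ⟨y, hy, hd⟩ := hΓ.exists_infDist_eq_dist hΓne w
      have hu : ∀ y' ∈ frontier Ω, dist w y' = infDist w (frontier Ω) → y' = y := by
        intro y' hy' hd'
        by_contra h
        exact hwH (hsk ⟨hwΩ, y', ⟨hy', hd'⟩, y, ⟨hy, hd.symm⟩, h⟩)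
      have h1 := eventually_lt_infDist_of_unique hΓ hwf hy hu hc1
      have h2 : ∀ᶠ ε in nhdsWithin (0 : ℝ) (Ioi 0), w + ε • (w - y) ∈ Ω := by
        have : Continuous fun ε : ℝ => w + ε • (w - y) := by fun_prop
        have h := this.tendsto 0
        simp only [zero_smul, add_zero] at h
        exact (h.mono_left nhdsWithin_le_nhds).eventually (hop.mem_nhds hwΩ)
      obtain ⟨ε, h3, h4⟩ := (h1.and h2).exists
      have h5 := hmax (subset_closure h4)
      simp only [mem_ofPred_eq] at h5
      have h6 : dist (w + ε • (w - y)) z ≤ ‖ε • (w - y)‖ + dist w z := by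
        refine (dist_triangle _ w _).trans_eq ?_
        rw [dist_self_add_left]
      nlinarith
  refine le_of_tendsto (f := fun c : ℝ => c * infDist z (highRidge Ω))
    (x := nhdsWithin (1 : ℝ) (Iio 1)) ?_ ?_
  · have : Continuous fun c : ℝ => c * infDist z (highRidge Ω) := by fun_prop
    simpa using (this.tendsto 1).mono_left nhdsWithin_le_nhds
  · filter_upwards [Ioo_mem_nhdsLT (zero_lt_one' ℝ)] with c hc
    exact key c hc.1 hc.2

lemma HasDerivAt.mul_of_eq_zero {a f : ℝ → ℝ} {s f' : ℝ} (ha : ContinuousAt a s)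
    (hf : HasDerivAt f f' s) (h0 : f s = 0) : HasDerivAt (fun t => a t * f t) (a s * f') s := by
  rw [hasDerivAt_iff_tendsto_slope] at hf ⊢
  refine ((ha.tendsto.mono_left nhdsWithin_le_nhds).mul hf).congr fun t => ?_
  simp only [slope_def_field, h0, mul_zero, sub_zero]
  ring

/-- A second order condition at a local minimum. -/
lemma mul_nonneg_of_isLocalMin {h a f : ℝ → ℝ} {s f' : ℝ} (hh : ∀ t, HasDerivAt h (a t * f t) t)
    (ha : ContinuousAt a s) (hf : HasDerivAt f f' s) (h0 : f s = 0) (hmin : IsLocalMin h s) :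
    0 ≤ a s * f' := by
  by_contra! hlt
  have hd : deriv h = fun t => a t * f t := funext fun t => (hh t).deriv
  have hdd := HasDerivAt.mul_of_eq_zero ha hf h0
  rw [← hd] at hdd
  have hmax := isLocalMax_of_deriv_deriv_neg (by rwa [hdd.deriv]) (by rw [hd]; simp [h0])
    (hh s).continuousAt
  have hc : h =ᶠ[nhds s] fun _ => h s := by
    filter_upwards [hmin, hmax] with t h1 h2 using le_antisymm h2 h1
  have hz : deriv (deriv h) s = 0 := by
    rw [hc.deriv.deriv_eq]
    simp
  rw [hdd.deriv] at hz
  exact hlt.ne hz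

lemma HasDerivAt.nonneg_of_eventually_nonneg {F : ℝ → ℝ} {F' : ℝ} (hF : HasDerivAt F F' 0)
    (h0 : F 0 = 0) (h : ∀ᶠ t in nhdsWithin 0 (Ioi 0), 0 ≤ F t) : 0 ≤ F' := by
  have h1 := (hasDerivAt_iff_tendsto_slope.1 hF).mono_left
    (nhdsWithin_mono 0 (show Ioi (0 : ℝ) ⊆ {0}ᶜ from fun t ht => ne_of_gt ht))
  refine ge_of_tendsto h1 ?_
  filter_upwards [h, self_mem_nhdsWithin] with t ht ht0
  rw [slope_def_field, h0, sub_zero, sub_zero]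
  exact div_nonneg ht (le_of_lt ht0)

/-- The speed of the graph of `g`. -/
def graphSpeed (g : ℝ → ℝ) (s : ℝ) : ℝ := √(1 + deriv g s ^ 2)

/-- The abscissa of the point at distance `ρ` above the graph of `g` along the normal at `s`. -/
def offsetX (ρ : ℝ) (g : ℝ → ℝ) (s : ℝ) : ℝ := s - ρ * (deriv g s / graphSpeed g s)

/-- The ordinate of the point at distance `ρ` above the graph of `g` along the normal at `s`. -/
def offsetY (ρ : ℝ) (g : ℝ → ℝ) (s : ℝ) : ℝ := g s + ρ * (1 / graphSpeed g s)

/-- `1 - ρ κ`, where `κ` is the curvature of the graph of `g`. -/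
def focalFactor (ρ : ℝ) (g : ℝ → ℝ) (s : ℝ) : ℝ :=
  1 - ρ * (deriv (deriv g) s / graphSpeed g s ^ 3)

section Graph

variable {g : ℝ → ℝ} (ρ : ℝ) (s : ℝ)

lemma graphSpeed_pos : 0 < graphSpeed g s := Real.sqrt_pos.2 (by positivity)

lemma graphSpeed_sq : graphSpeed g s ^ 2 = 1 + deriv g s ^ 2 := Real.sq_sqrt (by positivity)

lemma hasDerivAt_of_contDiff_two (hg : ContDiff ℝ 2 g) : HasDerivAt g (deriv g s) s :=
  ((hg.differentiable two_ne_zero) s).hasDerivAt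

lemma contDiff_deriv_of_contDiff_two (hg : ContDiff ℝ 2 g) : ContDiff ℝ 1 (deriv g) :=
  ((contDiff_succ_iff_deriv (n := 1)).1 (by simpa [one_add_one_eq_two] using hg)).2.2

lemma hasDerivAt_deriv_of_contDiff_two (hg : ContDiff ℝ 2 g) :
    HasDerivAt (deriv g) (deriv (deriv g) s) s :=
  (((contDiff_deriv_of_contDiff_two hg).differentiable one_ne_zero) s).hasDerivAt

lemma hasDerivAt_graphSpeed (hg : ContDiff ℝ 2 g) :
    HasDerivAt (graphSpeed g) (deriv g s * deriv (deriv g) s / graphSpeed g s) s := by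
  have h := (((hasDerivAt_deriv_of_contDiff_two s hg).pow 2).const_add 1).sqrt
    (by positivity : 1 + deriv g s ^ 2 ≠ 0)
  refine h.congr_deriv ?_
  have := (graphSpeed_pos (g := g) s).ne'
  simp only [graphSpeed, Pi.pow_apply, Nat.cast_ofNat, Nat.add_one_sub_one, pow_one] at this ⊢
  field_simp

lemma continuous_focalFactor (hg : ContDiff ℝ 2 g) : Continuous (focalFactor ρ g) := by
  have h1 : Continuous (deriv (deriv g)) :=
    (contDiff_deriv_of_contDiff_two hg).continuous_deriv le_rfl
  have h2 : Continuous (graphSpeed g) :=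
    continuous_iff_continuousAt.2 fun s => (hasDerivAt_graphSpeed s hg).continuousAt
  exact continuous_const.sub (continuous_const.mul
    (h1.div (h2.pow 3) fun s => (pow_pos (graphSpeed_pos s) 3).ne'))

lemma hasDerivAt_offsetX (hg : ContDiff ℝ 2 g) :
    HasDerivAt (offsetX ρ g) (focalFactor ρ g s) s := by
  have hW := graphSpeed_pos (g := g) s
  have h := (hasDerivAt_id s).sub
    (((hasDerivAt_deriv_of_contDiff_two s hg).div (hasDerivAt_graphSpeed s hg) hW.ne').const_mul ρ)
  refine h.congr_deriv ?_
  have h2 := graphSpeed_sq (g := g) s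
  simp only [focalFactor]
  field_simp
  rw [h2]
  ring

lemma hasDerivAt_offsetY (hg : ContDiff ℝ 2 g) :
    HasDerivAt (offsetY ρ g) (focalFactor ρ g s * deriv g s) s := by
  have hW := graphSpeed_pos (g := g) s
  have h := (hasDerivAt_of_contDiff_two s hg).add
    (((hasDerivAt_const s (1 : ℝ)).div (hasDerivAt_graphSpeed s hg) hW.ne').const_mul ρ)
  refine h.congr_deriv ?_
  simp only [focalFactor]
  field_simp
  ring

lemma hasDerivAt_offset_dist_sq (hg : ContDiff ℝ 2 g) (p q : ℝ) :
    HasDerivAt (fun t => (offsetX ρ g t - p) ^ 2 + (offsetY ρ g t - q) ^ 2)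
      (2 * focalFactor ρ g s * (offsetX ρ g s - p + deriv g s * (offsetY ρ g s - q))) s := by
  have h := (((hasDerivAt_offsetX ρ s hg).sub_const p).pow 2).add
    (((hasDerivAt_offsetY ρ s hg).sub_const q).pow 2)
  refine h.congr_deriv ?_
  simp
  ring

lemma hasDerivAt_offset_tangent (hg : ContDiff ℝ 2 g) (p q : ℝ) :
    HasDerivAt (fun t => offsetX ρ g t - p + deriv g t * (offsetY ρ g t - q))
      (focalFactor ρ g s * graphSpeed g s ^ 2 + deriv (deriv g) s * (offsetY ρ g s - q)) s := by
  have h := ((hasDerivAt_offsetX ρ s hg).sub_const p).add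
    ((hasDerivAt_deriv_of_contDiff_two s hg).mul ((hasDerivAt_offsetY ρ s hg).sub_const q))
  refine h.congr_deriv ?_
  rw [graphSpeed_sq]
  ring

variable {ρ s}

/-- If the offset curve stays at distance at least `ρ` from the foot point, the focal factor is
nonnegative. -/
lemma focalFactor_nonneg (hg : ContDiff ℝ 2 g)
    (h : IsLocalMin (fun t => (offsetX ρ g t - s) ^ 2 + (offsetY ρ g t - g s) ^ 2) s) :
    0 ≤ focalFactor ρ g s := by
  have hW := graphSpeed_pos (g := g) s
  have h1 := mul_nonneg_of_isLocalMin (fun t => hasDerivAt_offset_dist_sq ρ t hg s (g s))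
    ((continuous_const.mul (continuous_focalFactor ρ hg)).continuousAt)
    (hasDerivAt_offset_tangent ρ s hg s (g s)) (by simp only [offsetX, offsetY]; ring) h
  have h2 : focalFactor ρ g s * graphSpeed g s ^ 2 + deriv (deriv g) s * (offsetY ρ g s - g s) =
      graphSpeed g s ^ 2 := by
    simp only [focalFactor, offsetY]
    field_simp
    ring
  rw [h2] at h1
  by_contra! h3
  nlinarith [pow_pos hW 2]

/-- If the offset curve stays at distance at least `ρ` from the reflected foot point, a positive
focal factor is at least one half. -/
lemma half_le_focalFactor (hg : ContDiff ℝ 2 g) (ha : 0 < focalFactor ρ g s)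
    (h : IsLocalMin (fun t => (offsetX ρ g t - (2 * offsetX ρ g s - s)) ^ 2 +
      (offsetY ρ g t - (2 * offsetY ρ g s - g s)) ^ 2) s) :
    1 / 2 ≤ focalFactor ρ g s := by
  have hW := graphSpeed_pos (g := g) s
  have h1 := mul_nonneg_of_isLocalMin (fun t => hasDerivAt_offset_dist_sq ρ t hg _ _)
    ((continuous_const.mul (continuous_focalFactor ρ hg)).continuousAt)
    (hasDerivAt_offset_tangent ρ s hg (2 * offsetX ρ g s - s) (2 * offsetY ρ g s - g s))
    (by simp only [offsetX, offsetY]; ring) h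
  have h2 : focalFactor ρ g s * graphSpeed g s ^ 2 +
      deriv (deriv g) s * (offsetY ρ g s - (2 * offsetY ρ g s - g s)) =
      graphSpeed g s ^ 2 * (2 * focalFactor ρ g s - 1) := by
    simp only [focalFactor, offsetY]
    field_simp
    ring
  rw [h2] at h1
  by_contra! h3
  have h4 : 0 < focalFactor ρ g s * graphSpeed g s ^ 2 := by positivity
  nlinarith

/-- The point realising the distance to the graph of `g` from above lies on the offset curve. -/
lemma eq_offset_of_isLocalMin (hg : ContDiff ℝ 2 g) (hρ : 0 < ρ) {p q : ℝ}
    (hmin : IsLocalMin (fun t => (t - p) ^ 2 + (g t - q) ^ 2) s)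
    (hd : (s - p) ^ 2 + (g s - q) ^ 2 = ρ ^ 2)
    (habove : ∀ᶠ ε in nhdsWithin (0 : ℝ) (Ioi 0),
      g (s + ε * (p - s)) ≤ g s + ε * (q - g s)) :
    p = offsetX ρ g s ∧ q = offsetY ρ g s := by
  have hg1 := hasDerivAt_of_contDiff_two s hg
  have h1 : (s - p) + (g s - q) * deriv g s = 0 := by
    have h := (((hasDerivAt_id s).sub_const p).pow 2).add ((hg1.sub_const q).pow 2)
    have := hmin.hasDerivAt_eq_zero h
    simp at this
    linarith
  have h2 : 0 ≤ (q - g s) - deriv g s * (p - s) := by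
    refine HasDerivAt.nonneg_of_eventually_nonneg
      (F := fun ε => g s + ε * (q - g s) - g (s + ε * (p - s))) ?_ (by simp) ?_
    · have h3 : HasDerivAt (fun ε => s + ε * (p - s)) (p - s) 0 := by
        simpa using ((hasDerivAt_id (0 : ℝ)).mul_const (p - s)).const_add s
      have h4 : HasDerivAt (fun ε => g s + ε * (q - g s)) (q - g s) 0 := by
        simpa using ((hasDerivAt_id (0 : ℝ)).mul_const (q - g s)).const_add (g s)
      have h5 : HasDerivAt (fun ε => g (s + ε * (p - s))) (deriv g s * (p - s)) 0 := by
        refine HasDerivAt.comp (h₂ := g) (0 : ℝ) ?_ h3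
        simpa using hg1
      exact h4.sub h5
    · filter_upwards [habove] with ε hε using sub_nonneg.2 hε
  have hW := graphSpeed_pos (g := g) s
  have hW2 := graphSpeed_sq (g := g) s
  have h3 : p - s = -((q - g s) * deriv g s) := by linarith
  have h4 : 0 ≤ (q - g s) * graphSpeed g s ^ 2 := by rw [hW2]; rw [h3] at h2; linarith
  have h5 : 0 ≤ q - g s := nonneg_of_mul_nonneg_left h4 (pow_pos hW 2)
  have h6 : ((q - g s) * graphSpeed g s) ^ 2 = ρ ^ 2 := by
    rw [mul_pow, hW2, ← hd, show s - p = (q - g s) * deriv g s by linarith]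
    ring
  have h7 : (q - g s) * graphSpeed g s = ρ :=
    (sq_eq_sq₀ (mul_nonneg h5 hW.le) hρ.le).1 h6
  have h8 : q - g s = ρ / graphSpeed g s := by rw [eq_div_iff hW.ne', h7]
  constructor
  · rw [h8] at h3
    simp only [offsetX]
    linear_combination h3
  · simp only [offsetY]
    linear_combination h8

end Graph

/-- `H` consists of points at distance `ρ` from the complement of `Ω`, covers the boundary, and has
a dense subset of points with several closest boundary points. -/
structure IsEquidistantRidge (Ω H : Set E2) (ρ : ℝ) : Prop where
  pos : 0 < ρ
  le_dist : ∀ x ∈ H, ∀ y ∈ frontier Ω, ρ ≤ dist x y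
  exists_dist_eq : ∀ y ∈ frontier Ω, ∃ x ∈ H, dist x y = ρ
  ball_subset : ∀ x ∈ H, ball x ρ ⊆ Ω
  frequently : ∀ x ∈ H, ∃ᶠ z in nhds x, z ∈ H ∧
    ∃ y ∈ frontier Ω, ∃ y' ∈ frontier Ω, y ≠ y' ∧ dist z y = ρ ∧ dist z y' = ρ

/-- In the coordinates `e`, the set `Ω` is the epigraph of `g` inside the open set `U`. -/
structure IsGraphChart (Ω : Set E2) (e : E2 ≃ᵃⁱ[ℝ] E2) (U : Set E2) (g : ℝ → ℝ) : Prop where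
  isOpen : IsOpen U
  contDiff : ContDiff ℝ 2 g
  mem_iff : ∀ z ∈ U, z ∈ Ω ↔ g (e z 0) < e z 1
  mem_frontier_iff : ∀ z ∈ U, z ∈ frontier Ω ↔ g (e z 0) = e z 1

lemma sq_dist_eq_of_coords (e : E2 ≃ᵃⁱ[ℝ] E2) (z w : E2) :
    dist z w ^ 2 = (e z 0 - e w 0) ^ 2 + (e z 1 - e w 1) ^ 2 := by
  rw [← e.dist_map, EuclideanSpace.dist_eq, Real.sq_sqrt (by positivity), Fin.sum_univ_two,
    Real.dist_eq, Real.dist_eq, sq_abs, sq_abs]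

lemma eq_of_coords_eq (e : E2 ≃ᵃⁱ[ℝ] E2) {z w : E2} (h0 : e z 0 = e w 0) (h1 : e z 1 = e w 1) :
    z = w := by
  have := sq_dist_eq_of_coords e z w
  rw [h0, h1] at this
  simpa using this

lemma coord_add_smul_sub (e : E2 ≃ᵃⁱ[ℝ] E2) (y x : E2) (c : ℝ) (i : Fin 2) :
    e (y + c • (x - y)) i = e y i + c * (e x i - e y i) := by
  have h : e (y + c • (x - y)) = c • (e x - e y) + e y := by
    rw [add_comm, ← vadd_eq_add, e.map_vadd, map_smul, ← vsub_eq_sub x y, e.map_vsub]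
    rfl
  rw [h]
  simp
  ring

lemma continuous_coord (e : E2 ≃ᵃⁱ[ℝ] E2) (i : Fin 2) : Continuous fun z => e z i :=
  (EuclideanSpace.proj (𝕜 := ℝ) i).continuous.comp e.continuous

namespace IsGraphChart

variable {Ω H U : Set E2} {ρ : ℝ} {e : E2 ≃ᵃⁱ[ℝ] E2} {g : ℝ → ℝ} {x y : E2}

/-- The boundary is parametrised by the graph. -/
lemma eventually_exists_frontier (C : IsGraphChart Ω e U g) (hyU : y ∈ U) (hy : y ∈ frontier Ω) :
    ∀ᶠ t in nhds (e y 0), ∃ z ∈ U, z ∈ frontier Ω ∧ e z 0 = t ∧ e z 1 = g t := by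
  have hc : Continuous fun t => e.symm !₂[t, g t] := by
    refine e.symm.continuous.comp ((PiLp.continuous_toLp 2 _).comp (continuous_pi fun i => ?_))
    fin_cases i
    · exact continuous_id
    · exact C.contDiff.continuous
  have h0 : e.symm !₂[e y 0, g (e y 0)] = y := by
    apply eq_of_coords_eq e
    · simp
    · simpa using (C.mem_frontier_iff y hyU).1 hy
  have hU : ∀ᶠ t in nhds (e y 0), e.symm !₂[t, g t] ∈ U :=
    hc.continuousAt.eventually (C.isOpen.mem_nhds (by simpa only [h0] using hyU))
  filter_upwards [hU] with t ht
  exact ⟨_, ht, (C.mem_frontier_iff _ ht).2 (by simp), by simp, by simp⟩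

lemma eq_offset (C : IsGraphChart Ω e U g) (R : IsEquidistantRidge Ω H ρ) (hyU : y ∈ U)
    (hy : y ∈ frontier Ω) (hx : x ∈ H) (hd : dist x y = ρ) :
    e x 0 = offsetX ρ g (e y 0) ∧ e x 1 = offsetY ρ g (e y 0) := by
  have hg := (C.mem_frontier_iff y hyU).1 hy
  have hd2 : (e y 0 - e x 0) ^ 2 + (g (e y 0) - e x 1) ^ 2 = ρ ^ 2 := by
    rw [hg, ← sq_dist_eq_of_coords, dist_comm, hd]
  refine eq_offset_of_isLocalMin C.contDiff R.pos ?_ hd2 ?_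
  · filter_upwards [C.eventually_exists_frontier hyU hy] with t ⟨z, _, hz, hz0, hz1⟩
    rw [hd2, ← hz1, ← hz0, ← sq_dist_eq_of_coords, dist_comm]
    exact pow_le_pow_left₀ R.pos.le (R.le_dist x hx z hz) 2
  · have hc : Continuous fun ε : ℝ => y + ε • (x - y) := by fun_prop
    have hU : ∀ᶠ ε in nhdsWithin (0 : ℝ) (Ioi 0), y + ε • (x - y) ∈ U :=
      (hc.continuousAt.mono_left nhdsWithin_le_nhds).eventually
        (C.isOpen.mem_nhds (by simpa using hyU))
    filter_upwards [hU, Ioo_mem_nhdsGT (zero_lt_one' ℝ)] with ε hεU hε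
    have hΩ : y + ε • (x - y) ∈ Ω := by
      apply R.ball_subset x hx
      have : y + ε • (x - y) - x = (1 - ε) • (y - x) := by module
      rw [mem_ball, dist_eq_norm, this, norm_smul, norm_sub_rev y x, ← dist_eq_norm x y, hd,
        Real.norm_of_nonneg (by linarith [hε.2])]
      nlinarith [R.pos, hε.1]
    have := (C.mem_iff _ hεU).1 hΩ
    rw [coord_add_smul_sub, coord_add_smul_sub, ← hg] at this
    exact this.le

lemma isLocalMin_offset (C : IsGraphChart Ω e U g) (R : IsEquidistantRidge Ω H ρ) (hyU : y ∈ U)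
    (hy : y ∈ frontier Ω) (hx : x ∈ H) (hd : dist x y = ρ) {p : E2} (hp : p ∈ frontier Ω)
    (hpd : dist x p = ρ) :
    IsLocalMin (fun t => (offsetX ρ g t - e p 0) ^ 2 + (offsetY ρ g t - e p 1) ^ 2) (e y 0) := by
  have h := C.eq_offset R hyU hy hx hd
  filter_upwards [C.eventually_exists_frontier hyU hy] with t ⟨z, hzU, hz, hz0, _⟩
  obtain ⟨x', hx', hd'⟩ := R.exists_dist_eq z hz
  have h' := C.eq_offset R hzU hz hx' hd'
  rw [← h.1, ← h.2, ← sq_dist_eq_of_coords, hpd, ← hz0, ← h'.1, ← h'.2, ← sq_dist_eq_of_coords]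
  exact pow_le_pow_left₀ R.pos.le (R.le_dist x' hx' p hp) 2

lemma eq_or_eq_of_focalFactor_ne_zero (C : IsGraphChart Ω e U g) (R : IsEquidistantRidge Ω H ρ)
    (hyU : y ∈ U) (hy : y ∈ frontier Ω) (hx : x ∈ H) (hd : dist x y = ρ)
    (ha : focalFactor ρ g (e y 0) ≠ 0) {p : E2} (hp : p ∈ frontier Ω) (hpd : dist x p = ρ) :
    p = y ∨ p = y + (2 : ℝ) • (x - y) := by
  have hg := (C.mem_frontier_iff y hyU).1 hy
  have h := C.eq_offset R hyU hy hx hd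
  have h1 := (C.isLocalMin_offset R hyU hy hx hd hp hpd).hasDerivAt_eq_zero
    (hasDerivAt_offset_dist_sq ρ _ C.contDiff _ _)
  have h2 := (mul_eq_zero.1 h1).resolve_left (mul_ne_zero two_ne_zero ha)
  have h3 := sq_dist_eq_of_coords e x p
  have h4 := sq_dist_eq_of_coords e x y
  have hW := graphSpeed_pos (g := g) (e y 0)
  have hW2 := graphSpeed_sq (g := g) (e y 0)
  rw [← h.1, ← h.2] at h2
  have h5 : e x 0 - e y 0 = -(deriv g (e y 0) * (e x 1 - e y 1)) := by
    rw [← hg, h.1, h.2]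
    simp only [offsetX, offsetY]
    ring
  have h2' : e x 0 - e p 0 = -(deriv g (e y 0) * (e x 1 - e p 1)) := by linarith
  have h6 : (e x 1 - e p 1) ^ 2 = (e x 1 - e y 1) ^ 2 := by
    rw [hpd, ← hd, h4, h2', h5] at h3
    have : graphSpeed g (e y 0) ^ 2 * (e x 1 - e p 1) ^ 2 =
        graphSpeed g (e y 0) ^ 2 * (e x 1 - e y 1) ^ 2 := by
      rw [hW2]
      linarith
    exact mul_left_cancel₀ (pow_pos hW 2).ne' this
  rcases sq_eq_sq_iff_eq_or_eq_neg.1 h6 with h7 | h7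
  · left
    rw [h7] at h2'
    exact eq_of_coords_eq e (by linarith) (by linarith)
  · right
    rw [h7] at h2'
    apply eq_of_coords_eq e
    · rw [coord_add_smul_sub]
      linarith
    · rw [coord_add_smul_sub]
      linarith

lemma reflection_mem_frontier (C : IsGraphChart Ω e U g) (R : IsEquidistantRidge Ω H ρ)
    (hΓ : IsCompact (frontier Ω)) (hyU : y ∈ U) (hy : y ∈ frontier Ω) (hx : x ∈ H)
    (hd : dist x y = ρ) (ha : 0 < focalFactor ρ g (e y 0)) :
    y + (2 : ℝ) • (x - y) ∈ frontier Ω := by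
  by_contra hn
  obtain ⟨δ, hδ, hδa⟩ := Metric.eventually_nhds_iff.1
    ((continuous_focalFactor ρ C.contDiff).continuousAt.eventually (lt_mem_nhds ha))
  have hmono : StrictMonoOn (offsetX ρ g) (ball (e y 0) δ) := by
    refine strictMonoOn_of_deriv_pos (convex_ball _ _)
      (fun t _ => (hasDerivAt_offsetX ρ t C.contDiff).continuousAt.continuousWithinAt) fun t ht => ?_
    rw [(hasDerivAt_offsetX ρ t C.contDiff).deriv]
    exact hδa (mem_ball.1 (interior_subset ht))
  set V : Set E2 := U ∩ (fun z => e z 0) ⁻¹' ball (e y 0) δ with hV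
  have hVo : IsOpen V := C.isOpen.inter (isOpen_ball.preimage (continuous_coord e 0))
  have hyV : y ∈ V := ⟨hyU, mem_ball_self hδ⟩
  have hfar : ∀ᶠ z in nhds x, ∀ p ∈ frontier Ω \ V, dist z p ≠ ρ := by
    refine (hΓ.diff hVo).eventually_forall_of_forall_eventually fun p hp => ?_
    have hne : dist x p ≠ ρ := fun h => by
      rcases C.eq_or_eq_of_focalFactor_ne_zero R hyU hy hx hd ha.ne' hp.1 h with h | h
      · exact hp.2 (h ▸ hyV)
      · exact hn (h ▸ hp.1)
    exact (continuous_dist.continuousAt (x := (x, p))).eventually_ne hne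
  obtain ⟨z, ⟨hz, p, hp, p', hp', hpp, hzp, hzp'⟩, hzf⟩ :=
    ((R.frequently x hx).and_eventually hfar).exists
  have hpV : p ∈ V := by
    by_contra h
    exact hzf p ⟨hp, h⟩ hzp
  have hpV' : p' ∈ V := by
    by_contra h
    exact hzf p' ⟨hp', h⟩ hzp'
  have h0 : e p 0 = e p' 0 := hmono.injOn hpV.2 hpV'.2
    ((C.eq_offset R hpV.1 hp hz hzp).1.symm.trans (C.eq_offset R hpV'.1 hp' hz hzp').1)
  refine hpp (eq_of_coords_eq e h0 ?_)
  rw [← (C.mem_frontier_iff p hpV.1).1 hp, ← (C.mem_frontier_iff p' hpV'.1).1 hp', h0]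

lemma focalFactor_eq_zero_or_half_le (C : IsGraphChart Ω e U g) (R : IsEquidistantRidge Ω H ρ)
    (hΓ : IsCompact (frontier Ω)) (hyU : y ∈ U) (hy : y ∈ frontier Ω) (hx : x ∈ H)
    (hd : dist x y = ρ) :
    focalFactor ρ g (e y 0) = 0 ∨
      1 / 2 ≤ focalFactor ρ g (e y 0) ∧ y + (2 : ℝ) • (x - y) ∈ frontier Ω := by
  have hg := (C.mem_frontier_iff y hyU).1 hy
  have h := C.eq_offset R hyU hy hx hd
  have hm := C.isLocalMin_offset R hyU hy hx hd hy hd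
  rw [← hg] at hm
  rcases (focalFactor_nonneg C.contDiff hm).eq_or_lt with h0 | ha
  · exact Or.inl h0.symm
  · have hr := C.reflection_mem_frontier R hΓ hyU hy hx hd ha
    refine Or.inr ⟨half_le_focalFactor C.contDiff ha ?_, hr⟩
    have hrd : dist x (y + (2 : ℝ) • (x - y)) = ρ := by
      rw [← hd, dist_eq_norm, dist_eq_norm, ← norm_neg]
      congr 1
      module
    have hm' := C.isLocalMin_offset R hyU hy hx hd hr hrd
    rw [coord_add_smul_sub, coord_add_smul_sub] at hm'
    rw [← h.1, ← h.2, hg]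
    convert hm' using 5 <;> ring

/-- Where the focal factor vanishes the boundary is locally an arc of circle. -/
lemma eventually_mem_frontier_of_focalFactor_eq_zero (C : IsGraphChart Ω e U g)
    (R : IsEquidistantRidge Ω H ρ) (hΓ : IsCompact (frontier Ω)) (hyU : y ∈ U)
    (hy : y ∈ frontier Ω) (hx : x ∈ H) (hd : dist x y = ρ)
    (ha : focalFactor ρ g (e y 0) = 0) :
    ∀ᶠ z in nhds y, dist z x = ρ → z ∈ frontier Ω := by
  have hg := (C.mem_frontier_iff y hyU).1 hy
  have h := C.eq_offset R hyU hy hx hd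
  have hlt : ∀ᶠ t in nhds (e y 0), focalFactor ρ g t < 1 / 2 :=
    (continuous_focalFactor ρ C.contDiff).continuousAt.eventually
      (gt_mem_nhds (by rw [ha]; norm_num))
  obtain ⟨δ, hδ, hδa⟩ := Metric.eventually_nhds_iff.1
    (hlt.and (C.eventually_exists_frontier hyU hy))
  have hzero : ∀ t ∈ ball (e y 0) δ, focalFactor ρ g t = 0 := by
    intro t ht
    obtain ⟨h1, z, hzU, hz, rfl, -⟩ := hδa ht
    obtain ⟨x', hx', hd'⟩ := R.exists_dist_eq z hz
    rcases C.focalFactor_eq_zero_or_half_le R hΓ hzU hz hx' hd' with h2 | h2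
    · exact h2
    · linarith [h2.1]
  have hX : ∀ t ∈ ball (e y 0) δ, offsetX ρ g t = e x 0 := by
    intro t ht
    rw [h.1]
    refine isOpen_ball.is_const_of_deriv_eq_zero (convex_ball _ _).isPreconnected
      (fun t _ => (hasDerivAt_offsetX ρ t C.contDiff).differentiableAt.differentiableWithinAt)
      (fun t ht => ?_) ht (mem_ball_self hδ)
    rw [(hasDerivAt_offsetX ρ t C.contDiff).deriv, hzero t ht]
    rfl
  have hY : ∀ t ∈ ball (e y 0) δ, offsetY ρ g t = e x 1 := by
    intro t ht
    rw [h.2]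
    refine isOpen_ball.is_const_of_deriv_eq_zero (convex_ball _ _).isPreconnected
      (fun t _ => (hasDerivAt_offsetY ρ t C.contDiff).differentiableAt.differentiableWithinAt)
      (fun t ht => ?_) ht (mem_ball_self hδ)
    rw [(hasDerivAt_offsetY ρ t C.contDiff).deriv, hzero t ht, zero_mul]
    rfl
  have hbelow : e y 1 < e x 1 := by
    rw [← hg, h.2]
    have := mul_pos R.pos (one_div_pos.2 (graphSpeed_pos (g := g) (e y 0)))
    simp only [offsetY]
    linarith
  filter_upwards [C.isOpen.mem_nhds hyU,
    (continuous_coord e 0).continuousAt.eventually (ball_mem_nhds (e y 0) hδ),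
    (continuous_coord e 1).continuousAt.eventually (gt_mem_nhds hbelow)] with z hzU hz0 hz1 hzd
  rw [C.mem_frontier_iff z hzU]
  obtain ⟨-, w, hwU, hw, hw0, hw1⟩ := hδa hz0
  obtain ⟨x', hx', hd'⟩ := R.exists_dist_eq w hw
  have h' := C.eq_offset R hwU hw hx' hd'
  rw [hw0, hX _ hz0, hY _ hz0] at h'
  obtain rfl : x' = x := eq_of_coords_eq e h'.1 h'.2
  have h1 := sq_dist_eq_of_coords e x' w
  have h2 := sq_dist_eq_of_coords e z x'
  rw [hd', hw0, hw1] at h1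
  rw [hzd] at h2
  have h3 : (e x' 1 - g (e z 0)) ^ 2 = (e x' 1 - e z 1) ^ 2 := by nlinarith
  have h4 : g (e z 0) < e x' 1 := by
    rw [← hY _ hz0]
    have := mul_pos R.pos (one_div_pos.2 (graphSpeed_pos (g := g) (e z 0)))
    simp only [offsetY]
    linarith
  have := (sq_eq_sq₀ (sub_pos.2 h4).le (sub_pos.2 hz1).le).1 h3
  linarith

end IsGraphChart

/-- The closest boundary points of `x` are exactly `y` and its reflection through `x`. -/
def IsTwoSided (Ω : Set E2) (x y : E2) : Prop :=
  y + (2 : ℝ) • (x - y) ∈ frontier Ω ∧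
    ∀ p ∈ frontier Ω, dist x p = dist x y → p = y ∨ p = y + (2 : ℝ) • (x - y)

lemma IsEquidistantRidge.isTwoSided_or_eventually_mem_frontier {Ω H : Set E2} {ρ : ℝ}
    (R : IsEquidistantRidge Ω H ρ) (hΓ : IsCompact (frontier Ω)) (hreg : IsCkDomain2 2 Ω)
    {x y : E2} (hx : x ∈ H) (hy : y ∈ frontier Ω) (hd : dist x y = ρ) :
    IsTwoSided Ω x y ∨ ∀ᶠ z in nhds y, dist z x = ρ → z ∈ frontier Ω := by
  obtain ⟨e, U, g, hU, hyU, hg, h1, h2⟩ := hreg y hy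
  have C : IsGraphChart Ω e U g := ⟨hU, hg, h1, h2⟩
  rcases C.focalFactor_eq_zero_or_half_le R hΓ hyU hy hx hd with h | h
  · exact Or.inr (C.eventually_mem_frontier_of_focalFactor_eq_zero R hΓ hyU hy hx hd h)
  · exact Or.inl ⟨h.2, fun p hp hpd => C.eq_or_eq_of_focalFactor_ne_zero R hyU hy hx hd
      (by linarith [h.1]) hp (hpd.trans hd)⟩

/-- If a point of the ridge is not two-sided, the whole circle of its closest points lies in the
boundary. -/
lemma IsEquidistantRidge.sphere_subset_frontier {Ω H : Set E2} {ρ : ℝ}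
    (R : IsEquidistantRidge Ω H ρ) (hΓ : IsCompact (frontier Ω)) (hreg : IsCkDomain2 2 Ω)
    {x y : E2} (hx : x ∈ H) (hy : y ∈ frontier Ω) (hd : dist x y = ρ)
    (hn : ¬ IsTwoSided Ω x y) : sphere x ρ ⊆ frontier Ω := by
  have hrank : 1 < Module.rank ℝ E2 := by
    rw [← Module.finrank_eq_rank, finrank_euclideanSpace_fin]
    norm_num
  have hpc : PreconnectedSpace (sphere x ρ) :=
    isPreconnected_iff_preconnectedSpace.1 (isPreconnected_sphere hrank x ρ)
  have hys : y ∈ sphere x ρ := by rw [mem_sphere, dist_comm, hd]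
  have hcs : ConnectedSpace (sphere x ρ) := ⟨⟨⟨y, hys⟩⟩⟩
  have hnt : Nontrivial (sphere x ρ) := by
    have hr : y + (2 : ℝ) • (x - y) ∈ sphere x ρ := by
      rw [mem_sphere, ← hd, dist_eq_norm, dist_eq_norm]
      congr 1
      module
    refine ⟨⟨y, hys⟩, ⟨_, hr⟩, fun h => ?_⟩
    have h1 : (2 : ℝ) • (x - y) = 0 := by simpa using congrArg Subtype.val h
    have h2 : x = y := by simpa [sub_eq_zero] using h1
    have := R.pos
    rw [← hd, h2, dist_self] at this
    exact lt_irrefl _ this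
  set B : Set (sphere x ρ) := Subtype.val ⁻¹' frontier Ω with hB
  have harc : ∀ z : sphere x ρ, (∀ᶠ w in nhds (z : E2), dist w x = ρ → w ∈ frontier Ω) →
      z ∈ interior B := by
    intro z hz
    rw [mem_interior_iff_mem_nhds]
    filter_upwards [continuous_subtype_val.continuousAt.eventually hz] with w hw using hw w.2
  have hyB : (⟨y, hys⟩ : sphere x ρ) ∈ interior B :=
    harc _ ((R.isTwoSided_or_eventually_mem_frontier hΓ hreg hx hy hd).resolve_left hn)
  have hinf : B.Infinite := infinite_of_mem_nhds _ (mem_interior_iff_mem_nhds.1 hyB)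
  have hclosed : IsClosed (interior B) := by
    refine isClosed_of_closure_subset fun z hz => ?_
    have hzB : (z : E2) ∈ frontier Ω := by
      have hBc : IsClosed B := isClosed_frontier.preimage continuous_subtype_val
      exact hBc.closure_subset_iff.2 interior_subset hz
    have hzd : dist x z = ρ := by
      rw [dist_comm]
      exact z.2
    rcases R.isTwoSided_or_eventually_mem_frontier hΓ hreg hx hzB hzd with h | h
    · refine absurd ?_ hinf
      refine Finite.of_finite_image (f := Subtype.val) ((toFinite
        {(z : E2), (z : E2) + (2 : ℝ) • (x - z)}).subset ?_) Subtype.val_injective.injOn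
      rintro _ ⟨w, hw, rfl⟩
      exact h.2 w hw (by rw [hzd, dist_comm]; exact w.2)
    · exact harc z h
  rcases isClopen_iff.1 ⟨hclosed, isOpen_interior⟩ with h | h
  · rw [h] at hyB
    exact absurd hyB (notMem_empty _)
  · intro z hz
    have : (⟨z, hz⟩ : sphere x ρ) ∈ interior B := h ▸ mem_univ _
    exact interior_subset (s := B) this

lemma highRidge_subset {Ω : Set E2} (hop : IsOpen Ω) (hne : Ω.Nonempty)
    (hΓne : (frontier Ω).Nonempty) : highRidge Ω ⊆ Ω := by
  intro x hx
  obtain ⟨z, hz⟩ := hne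
  have hf : ∀ y ∈ closure Ω, y ∉ frontier Ω → y ∈ Ω := fun y hy h => by
    by_contra h'
    exact h (by rw [hop.frontier_eq]; exact ⟨hy, h'⟩)
  refine hf x hx.1 ((isClosed_frontier.notMem_iff_infDist_pos hΓne).2 ?_)
  refine lt_of_lt_of_le ?_ (hx.2 z (subset_closure hz))
  refine (isClosed_frontier.notMem_iff_infDist_pos hΓne).1 fun h => ?_
  rw [hop.frontier_eq] at h
  exact h.2 hz

lemma inradius_eq_infDist {Ω : Set E2} {x : E2} (hx : x ∈ highRidge Ω) :
    inradius Ω = infDist x (frontier Ω) := by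
  refine IsGreatest.csSup_eq ⟨⟨x, hx.1, rfl⟩, ?_⟩
  rintro _ ⟨z, hz, rfl⟩
  exact hx.2 z hz

lemma isEquidistantRidge_highRidge {Ω : Set E2} (hne : Ω.Nonempty) (hop : IsOpen Ω)
    (hbd : Bornology.IsBounded Ω) (hΓne : (frontier Ω).Nonempty)
    (hcut : highRidge Ω = cutLocus Ω) (hHne : (highRidge Ω).Nonempty) :
    IsEquidistantRidge Ω (highRidge Ω) (inradius Ω) := by
  have hK := hbd.isCompact_closure
  have hHΩ := highRidge_subset hop hne hΓne
  have hsk : skeleton Ω ⊆ highRidge Ω := hcut ▸ subset_closure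
  have hH : IsCompact (highRidge Ω) := by
    refine hK.of_isClosed_subset ?_ fun x hx => hx.1
    rw [hcut]
    exact isClosed_closure
  have hdisj : ∀ y ∈ frontier Ω, y ∉ Ω := fun y hy => by
    rw [hop.frontier_eq] at hy
    exact hy.2
  have hnu : Ω ≠ univ := fun h => by
    obtain ⟨y, hy⟩ := hΓne
    exact hdisj y hy (h ▸ mem_univ _)
  have hle : ∀ x ∈ highRidge Ω, ∀ y ∈ frontier Ω, inradius Ω ≤ dist x y := fun x hx y hy => by
    rw [inradius_eq_infDist hx]
    exact infDist_le_dist_of_mem hy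
  refine ⟨?_, hle, fun y hy => ?_, fun x hx => ?_, fun x hx => ?_⟩
  · obtain ⟨x, hx⟩ := hHne
    rw [inradius_eq_infDist hx]
    exact (isClosed_frontier.notMem_iff_infDist_pos hΓne).1 fun h => hdisj x h (hHΩ hx)
  · obtain ⟨x₀, hx₀⟩ := hHne
    have h := infDist_highRidge_le hop hbd hsk hx₀ (frontier_subset_closure hy)
    obtain ⟨x, hx, hd⟩ := hH.exists_infDist_eq_dist ⟨x₀, hx₀⟩ y
    rw [infDist_zero_of_mem hy, sub_zero, ← inradius_eq_infDist hx₀, hd, dist_comm] at h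
    exact ⟨x, hx, le_antisymm h (hle x hx y hy)⟩
  · have := ball_infDist_compl_subset (x := x) (s := Ω)
    rwa [infDist_compl_eq_infDist_frontier hop hnu (hHΩ hx), ← inradius_eq_infDist hx] at this
  · have hx' : x ∈ closure (skeleton Ω) := by
      rw [hcut] at hx
      exact hx
    refine (mem_closure_iff_frequently.1 hx').mono fun z hz => ⟨hsk hz, ?_⟩
    obtain ⟨y, hy, y', hy', hyy⟩ := hz.2
    rw [inradius_eq_infDist (hsk hz)]
    exact ⟨y, hy.1, y', hy'.1, hyy, hy.2, hy'.2⟩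

/-- **Theorem.** Let `Ω ⊂ ℝ²` be a nonempty open bounded connected and simply connected
domain of class `C²` whose high ridge and cut locus coincide, `S := H(Ω) = Cut(Ω)`.
Then `S` is a singleton `{p}` and `Ω` is the open disk of center `p` and radius
`ρ_Ω := max_{closure Ω} d_{∂Ω}`. -/
theorem stmt6 (Ω : Set E2) (hne : Ω.Nonempty) (hop : IsOpen Ω)
    (hbd : Bornology.IsBounded Ω) (hconn : IsConnected Ω)
    (hsimp : SimplyConnectedSpace ↥Ω) (hreg : IsCkDomain2 2 Ω)
    (S : Set E2) (hS : S = highRidge Ω) (hScut : highRidge Ω = cutLocus Ω) :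
    ∃ p : E2, S = {p} ∧ Ω = Metric.ball p (inradius Ω) := by
  subst hS
  have hK := hbd.isCompact_closure
  have hΓ : IsCompact (frontier Ω) := hK.of_isClosed_subset isClosed_frontier
    frontier_subset_closure
  have hΓne : (frontier Ω).Nonempty := by
    rw [nonempty_iff_ne_empty]
    intro h
    rcases isClopen_iff.1 (isClopen_iff_frontier_eq_empty.2 h) with h | h
    · exact hne.ne_empty h
    · rw [h] at hbd
      exact NormedSpace.unbounded_univ ℝ E2 hbd
  have hdisj : ∀ y ∈ frontier Ω, y ∉ Ω := fun y hy => by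
    rw [hop.frontier_eq] at hy
    exact hy.2
  have hHne : (highRidge Ω).Nonempty := by
    obtain ⟨x, hx, hmax⟩ := hK.exists_isMaxOn hne.closure
      (continuous_infDist_pt (frontier Ω)).continuousOn
    exact ⟨x, hx, fun z hz => hmax hz⟩
  have R := isEquidistantRidge_highRidge hne hop hbd hΓne hScut hHne
  set ρ := inradius Ω
  have hHΩ := highRidge_subset hop hne hΓne
  have hle : ∀ z ∈ Ω, infDist z (frontier Ω) ≤ ρ := by
    obtain ⟨x, hx⟩ := hHne
    intro z hz
    rw [show ρ = _ from inradius_eq_infDist hx]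
    exact hx.2 z (subset_closure hz)
  have hmem : ∀ z ∈ Ω, infDist z (frontier Ω) = ρ → z ∈ highRidge Ω := by
    obtain ⟨x, hx⟩ := hHne
    intro z hz h
    refine ⟨subset_closure hz, fun w hw => ?_⟩
    rw [h, show ρ = _ from inradius_eq_infDist hx]
    exact hx.2 w hw
  by_cases htwo : ∀ x ∈ highRidge Ω, ∀ y ∈ frontier Ω, dist x y = ρ → IsTwoSided Ω x y
  · exfalso
    obtain ⟨y, hy⟩ := hΓne
    obtain ⟨x, hx, hd⟩ := R.exists_dist_eq y hy
    have hxd := inradius_eq_infDist hx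
    have ht := htwo x hx y hy hd
    refine not_two_sided hop hbd hsimp R.pos hle ?_ ?_ (hHΩ hx) hxd.symm (u := y - x) ?_ ?_
    · intro z hz h p hp p' hp'
      by_contra hpp
      have : z ∈ highRidge Ω := by
        rw [hScut]
        exact subset_closure ⟨hz, p, hp, p', hp', hpp⟩
      exact h.ne (inradius_eq_infDist this).symm
    · intro z hz h p hp p' hp'
      rcases (htwo z (hmem z hz h) p hp.1 (hp.2.trans h)).2 p' hp'.1 (hp'.2.trans hp.2.symm)
        with h | h
      · left
        rw [h]
      · right
        rw [h]
        module
    · rw [add_sub_cancel]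
      exact ⟨hy, hd.trans hxd⟩
    · rw [show x - (y - x) = y + (2 : ℝ) • (x - y) by module]
      refine ⟨ht.1, ?_⟩
      rw [← hxd, show inradius Ω = dist x y from hd.symm, dist_eq_norm, dist_eq_norm, ← norm_neg]
      congr 1
      module
  · push Not at htwo
    obtain ⟨x, hx, y, hy, hd, hn⟩ := htwo
    have hsph := R.sphere_subset_frontier hΓ hreg hx hy hd hn
    have hball : Ω = ball x ρ := by
      refine Subset.antisymm ?_ (R.ball_subset x hx)
      refine hconn.isPreconnected.subset_of_closure_inter_subset isOpen_ball
        ⟨x, hHΩ hx, mem_ball_self R.pos⟩ fun z hz => ?_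
      refine lt_of_le_of_ne (mem_closedBall.1 (closure_ball_subset_closedBall hz.1)) fun h => ?_
      exact hdisj z (hsph h) hz.2
    refine ⟨x, subset_antisymm (fun z hz => ?_) (singleton_subset_iff.2 hx), hball⟩
    by_contra hzx
    have hpos : 0 < ‖z - x‖ := norm_pos_iff.2 (sub_ne_zero.2 hzx)
    have hlt : ‖z - x‖ < ρ := by
      have h := hHΩ hz
      rw [hball, mem_ball, dist_eq_norm] at h
      exact h
    have hp : x + (ρ / ‖z - x‖) • (z - x) ∈ sphere x ρ := by
      rw [mem_sphere, dist_self_add_left, norm_smul, Real.norm_of_nonneg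
        (div_nonneg R.pos.le hpos.le), div_mul_cancel₀ _ hpos.ne']
    have h1 := R.le_dist z hz _ (hsph hp)
    rw [dist_comm, dist_eq_norm, show x + (ρ / ‖z - x‖) • (z - x) - z =
      (ρ / ‖z - x‖ - 1) • (z - x) by module, norm_smul, Real.norm_of_nonneg
      (sub_nonneg.2 ((one_le_div hpos).2 hlt.le)), sub_mul, div_mul_cancel₀ _ hpos.ne'] at h1
    linarith
end
end

section
/- Let S ⊆ ℝ² satisfy (H1) and let r ∈ (0, r_S). Then, for the open tubular neighborhood S_r := {x ∈ ℝ² : d_S(x) < r}, one has S = H(S_r) = Σ(S_r) = M(S_r) = Cut(S_r). -/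
open Metric Set Real

noncomputable section

/-- The central set `M(Ω)`: the set of centers of maximal open balls contained in `Ω`
(an open ball contained in `Ω` is maximal if no strictly larger open ball containing it
is contained in `Ω`). -/
def centralSet (Ω : Set E2) : Set E2 :=
  {p | ∃ ρ : ℝ, 0 < ρ ∧ Metric.ball p ρ ⊆ Ω ∧
    ∀ (p' : E2) (ρ' : ℝ), Metric.ball p ρ ⊆ Metric.ball p' ρ' →
      Metric.ball p' ρ' ⊆ Ω → Metric.ball p' ρ' = Metric.ball p ρ}

/-- At a point of positive distance where the distance function is differentiable, it grows at unit
speed in some direction. -/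
theorem exists_infDist_line_hasDerivAt_one {S : Set E2} (hcl : IsClosed S) (hne : S.Nonempty)
    {z : E2} (hz : 0 < infDist z S) (hd : DifferentiableAt ℝ (fun x => infDist x S) z) :
    ∃ u : E2, ‖u‖ = 1 ∧ HasDerivAt (fun h : ℝ => infDist (z + h • u) S) 1 0 := by
  obtain ⟨s, hs, hsd⟩ := hcl.exists_infDist_eq_dist hne z
  have hpos : 0 < ‖z - s‖ := by rwa [← dist_eq_norm, ← hsd]
  set u : E2 := ‖z - s‖⁻¹ • (z - s) with hu
  have hun : ‖u‖ = 1 := by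
    rw [hu, norm_smul, norm_inv, norm_norm, inv_mul_cancel₀ hpos.ne']
  have hzs : z = s + ‖z - s‖ • u := by
    rw [hu, smul_smul, mul_inv_cancel₀ hpos.ne', one_smul]; abel
  have hda : DifferentiableAt ℝ (fun h : ℝ => infDist (z + h • u) S) 0 := by
    have h1 : DifferentiableAt ℝ (fun x => infDist x S) (z + (0 : ℝ) • u) := by simpa using hd
    exact h1.comp (0 : ℝ) (f := fun h : ℝ => z + h • u) (by fun_prop)
  refine ⟨u, hun, ?_⟩
  have hleft : HasDerivWithinAt (fun h : ℝ => infDist (z + h • u) S) 1 (Iic 0) 0 := by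
    have hlin : HasDerivWithinAt (fun h : ℝ => infDist z S + h) 1 (Iic 0) 0 :=
      ((hasDerivAt_id (0 : ℝ)).const_add _).hasDerivWithinAt
    refine hlin.congr_of_eventuallyEq ?_ (by simp)
    have hmem : Ioc (-‖z - s‖) 0 ∈ nhdsWithin (0 : ℝ) (Iic 0) :=
      Ioc_mem_nhdsLE (by linarith)
    filter_upwards [hmem] with h hh
    apply le_antisymm
    · refine (infDist_le_dist_of_mem hs).trans ?_
      have : z + h • u - s = (‖z - s‖ + h) • u := by
        rw [add_smul]; nth_rewrite 1 [hzs]; abel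
      rw [dist_eq_norm, this, norm_smul, hun, hsd, dist_eq_norm, Real.norm_eq_abs,
        abs_of_pos (by linarith [hh.1]), mul_one]
    · have h1 := infDist_le_infDist_add_dist (s := S) (x := z) (y := z + h • u)
      have h2 : dist z (z + h • u) = -h := by
        rw [dist_self_add_right, norm_smul, hun, mul_one, Real.norm_eq_abs, abs_of_nonpos hh.2]
      linarith
  have huniq := (uniqueDiffOn_Iic (0 : ℝ) 0 (by simp)).eq_deriv _
    hleft hda.hasDerivAt.hasDerivWithinAt
  rw [huniq]
  exact hda.hasDerivAt

/-- If the distance to `S` is differentiable where it lies in `(0, r]`, then from every such point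
the level `r` can be reached by a displacement of the minimal possible length. -/
theorem exists_infDist_ge_add {S : Set E2} (hcl : IsClosed S) (hne : S.Nonempty) {r : ℝ}
    (hd : ∀ z, 0 < infDist z S → infDist z S ≤ r → DifferentiableAt ℝ (fun x => infDist x S) z)
    {x : E2} (hx : 0 < infDist x S) (hxr : infDist x S ≤ r) :
    ∃ z, dist z x ≤ r - infDist x S ∧ infDist z S = r := by
  set R := r - infDist x S with hR
  have hR0 : 0 ≤ R := by linarith
  have hle : ∀ w, infDist w S ≤ infDist x S + dist w x := fun w => infDist_le_infDist_add_dist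
  have hcont : Continuous fun w => infDist w S := continuous_infDist_pt S
  have hK : IsCompact (closedBall x R) := isCompact_closedBall x R
  have hKne : (closedBall x R).Nonempty := ⟨x, by simpa using hR0⟩
  obtain ⟨z, hzK, hz⟩ := hK.exists_isMaxOn hKne hcont.continuousOn
  have hzx : dist z x ≤ R := hzK
  refine ⟨z, hzx, le_antisymm (by linarith [hle z]) ?_⟩
  have key : ∀ ε ∈ Ioo (0 : ℝ) 1, infDist x S + (1 - ε) * R ≤ infDist z S := by
    rintro ε ⟨hε, hε1⟩
    have hfc : Continuous fun w => infDist w S - (1 - ε) * dist w x := by fun_prop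
    obtain ⟨w, hwK, hw⟩ := hK.exists_isMaxOn hKne hfc.continuousOn
    have hwx : dist w x ≤ R := hwK
    have h0 : infDist x S ≤ infDist w S - (1 - ε) * dist w x := by
      simpa using hw (show x ∈ closedBall x R by simpa using hR0)
    have hwpos : 0 < infDist w S := by
      have : 0 ≤ (1 - ε) * dist w x := mul_nonneg (by linarith) dist_nonneg
      linarith
    have hwR : R ≤ dist w x := by
      by_contra! hlt
      obtain ⟨u, hu, hder⟩ := exists_infDist_line_hasDerivAt_one hcl hne hwpos
        (hd w hwpos (by linarith [hle w]))
      have hslope := (hasDerivAt_iff_tendsto_slope_zero.1 hder).mono_left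
        (nhdsGT_le_nhdsNE (0 : ℝ))
      have hev := hslope.eventually_const_lt (show 1 - ε < 1 by linarith)
      have hsmall : ∀ᶠ h : ℝ in nhdsWithin 0 (Ioi 0), h ∈ Ioo 0 (R - dist w x) :=
        Ioo_mem_nhdsGT (by linarith)
      obtain ⟨h, h1, h2, h3⟩ := (hev.and hsmall).exists
      simp only [zero_add, zero_smul, add_zero, smul_eq_mul] at h1
      rw [inv_mul_eq_div, lt_div_iff₀ h2] at h1
      have hstep : dist (w + h • u) x ≤ dist w x + h := by
        have h4 : dist (w + h • u) w = h := by
          rw [dist_self_add_left, norm_smul, hu, mul_one, Real.norm_eq_abs, abs_of_pos h2]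
        linarith [dist_triangle (w + h • u) w x]
      have h5 := hw (show w + h • u ∈ closedBall x R by
        rw [mem_closedBall]; linarith)
      simp only [mem_ofPred_eq] at h5
      have h6 := mul_le_mul_of_nonneg_left hstep (show 0 ≤ 1 - ε by linarith)
      linarith
    have h7 := mul_le_mul_of_nonneg_left hwR (show 0 ≤ 1 - ε by linarith)
    have h8 : infDist w S ≤ infDist z S := hz hwK
    linarith
  by_contra! hlt
  have hRpos : 0 < R := by
    by_contra! h
    have := key (1 / 2) (by norm_num)
    nlinarith
  set δ := r - infDist z S with hδ
  have hδR : δ / (2 * R) < 1 := by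
    rw [div_lt_one (by linarith)]
    have h1 := key (1 / 2) (by norm_num)
    linarith
  have := key (δ / (2 * R)) ⟨by apply div_pos <;> linarith, hδR⟩
  have h9 : δ / (2 * R) * R = δ / 2 := by field_simp
  nlinarith

theorem dist_add_le_of_ball_subset_ball {p q : E2} {a b : ℝ} (ha : 0 < a)
    (h : ball p a ⊆ ball q b) : a + dist p q ≤ b := by
  obtain ⟨v, hv, hpq⟩ : ∃ v : E2, ‖v‖ = 1 ∧ p - q = dist p q • v := by
    by_cases hpq : p = q
    · obtain ⟨v, hv⟩ := exists_norm_eq E2 (zero_le_one' ℝ)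
      exact ⟨v, hv, by simp [hpq]⟩
    · have h0 : ‖p - q‖ ≠ 0 := norm_ne_zero_iff.2 (sub_ne_zero.2 hpq)
      refine ⟨‖p - q‖⁻¹ • (p - q), ?_, ?_⟩
      · rw [norm_smul, norm_inv, norm_norm, inv_mul_cancel₀ h0]
      · rw [dist_eq_norm, smul_smul, mul_inv_cancel₀ h0, one_smul]
  refine le_of_forall_lt fun c hc => ?_
  have hd : 0 ≤ dist p q := dist_nonneg
  set t := max 0 (c - dist p q) with ht
  have ht0 : 0 ≤ t := le_max_left _ _
  have hta : t < a := max_lt ha (by linarith)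
  have hmem : p + t • v ∈ ball q b := h (by
    rw [mem_ball, dist_self_add_left, norm_smul, hv, mul_one, Real.norm_eq_abs, abs_of_nonneg ht0]
    exact hta)
  have heq : p + t • v - q = (dist p q + t) • v := by
    rw [add_smul, ← hpq]; abel
  rw [mem_ball, dist_eq_norm, heq, norm_smul, hv, mul_one, Real.norm_eq_abs,
    abs_of_nonneg (by linarith)] at hmem
  linarith [le_max_right 0 (c - dist p q)]

/-- A local maximum of the distance to a closed set, at positive distance, has several closest
points. -/
theorem exists_ne_of_isLocalMax_infDist {F : Set E2} (hF : IsClosed F) (hne : F.Nonempty)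
    {x : E2} (hx : 0 < infDist x F) (hmax : IsLocalMax (fun z => infDist z F) x) :
    ∃ y ∈ F, dist x y = infDist x F ∧ ∃ z ∈ F, dist x z = infDist x F ∧ y ≠ z := by
  obtain ⟨y, hy, hyd⟩ := hF.exists_infDist_eq_dist hne x
  refine ⟨y, hy, hyd.symm, ?_⟩
  by_contra! huniq
  set r := infDist x F with hr
  set n : E2 := y - x with hn
  have hnr : ‖n‖ = r := by rw [hn, ← dist_eq_norm, dist_comm, hyd]
  choose P hPF hPd using fun w => hF.exists_infDist_eq_dist hne w
  set w : ℕ → E2 := fun k => x - ((1 : ℝ) / (k + 1)) • n with hw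
  have hwx : Filter.Tendsto w Filter.atTop (nhds x) := by
    have := (tendsto_one_div_add_atTop_nhds_zero_nat (𝕜 := ℝ)).smul_const n
    simpa [hw] using this.const_sub x
  have hgw : Filter.Tendsto (fun k => infDist (w k) F) Filter.atTop (nhds r) :=
    ((continuous_infDist_pt F).tendsto x).comp hwx
  have hbdd : ∀ᶠ k in Filter.atTop, P (w k) ∈ closedBall x (r + 2) := by
    filter_upwards [hgw.eventually_lt_const (show r < r + 1 by linarith),
      hwx.eventually (ball_mem_nhds x one_pos)] with k h1 h2
    rw [hPd] at h1
    rw [mem_closedBall]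
    have h2' : dist (w k) x < 1 := h2
    linarith [dist_triangle (P (w k)) (w k) x, dist_comm (P (w k)) (w k)]
  obtain ⟨q, -, φ, hφ, hq⟩ :=
    (isCompact_closedBall x (r + 2)).tendsto_subseq' hbdd.frequently
  have hwφ := hwx.comp hφ.tendsto_atTop
  have hqF : q ∈ F := hF.mem_of_tendsto hq (Filter.Eventually.of_forall fun k => hPF _)
  have hqd : dist x q = r := by
    refine tendsto_nhds_unique (hwφ.dist hq) ?_
    refine (hgw.comp hφ.tendsto_atTop).congr fun k => ?_
    exact hPd _
  have hqy : q = y := (huniq q hqF hqd).symm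
  have hin : Filter.Tendsto (fun k => inner ℝ (P (w (φ k)) - x) n) Filter.atTop
      (nhds (inner ℝ (y - x) n)) := by
    rw [← hqy]
    exact (hq.sub_const x).inner tendsto_const_nhds
  have hpos : 0 < inner ℝ (y - x) n := by
    rw [← hn, real_inner_self_eq_norm_sq, hnr]; positivity
  have hmax' : ∀ᶠ k in Filter.atTop, infDist (w (φ k)) F ≤ r := hwφ.eventually hmax
  obtain ⟨k, hk1, hk2⟩ := ((hin.eventually_const_lt hpos).and hmax').exists
  have h1 : r ≤ ‖P (w (φ k)) - x‖ := by
    rw [← dist_eq_norm, dist_comm]; exact infDist_le_dist_of_mem (hPF _)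
  set t : ℝ := 1 / ((φ k : ℝ) + 1) with ht
  have ht0 : 0 < t := by positivity
  have h2 : ‖(P (w (φ k)) - x) + t • n‖ ≤ r := by
    rw [hPd, dist_comm, dist_eq_norm] at hk2
    have h5 : P (w (φ k)) - x + t • n = P (w (φ k)) - w (φ k) := by
      have h6 : w (φ k) = x - t • n := rfl
      nth_rewrite 3 [h6]
      abel
    rwa [h5]
  have h3 := norm_add_sq_real (P (w (φ k)) - x) (t • n)
  rw [inner_smul_right] at h3
  have h4 : 0 < t * inner ℝ (P (w (φ k)) - x) n := mul_pos ht0 hk1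
  nlinarith [sq_nonneg ‖t • n‖, norm_nonneg (P (w (φ k)) - x + t • n)]

theorem infDist_eq_of_mem_frontier_tube {S : Set E2} {r : ℝ} {p : E2}
    (hp : p ∈ frontier {x | infDist x S < r}) : infDist p S = r :=
  frontier_lt_subset_eq (continuous_infDist_pt S) continuous_const hp

theorem mem_frontier_tube_of_infDist_eq {S : Set E2} (hcl : IsClosed S) (hne : S.Nonempty)
    {r : ℝ} (hr : 0 < r) {p : E2} (hp : infDist p S = r) :
    p ∈ frontier {x | infDist x S < r} := by
  obtain ⟨s, hs, hsd⟩ := hcl.exists_infDist_eq_dist hne p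
  have hopen : IsOpen {x | infDist x S < r} :=
    isOpen_lt (continuous_infDist_pt S) continuous_const
  rw [hopen.frontier_eq]
  refine ⟨?_, fun h => (lt_irrefl r) (by rwa [mem_ofPred_eq, hp] at h)⟩
  have hsub : ball s r ⊆ {x | infDist x S < r} := fun y hy =>
    (infDist_le_dist_of_mem hs).trans_lt hy
  apply closure_mono hsub
  rw [closure_ball s hr.ne', mem_closedBall, ← hsd, hp]

/-- The distance to the boundary of the tube of radius `r` is `r - d_S` in the tube. -/
theorem infDist_frontier_tube {S : Set E2} (hcl : IsClosed S) (hne : S.Nonempty)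
    (hint : interior S = ∅) {r : ℝ} (hr : 0 < r)
    (hd : ∀ z, 0 < infDist z S → infDist z S ≤ r → DifferentiableAt ℝ (fun x => infDist x S) z) :
    (frontier {x | infDist x S < r}).Nonempty ∧
      ∀ x, infDist x S ≤ r → infDist x (frontier {x | infDist x S < r}) = r - infDist x S := by
  set F := frontier {x | infDist x S < r} with hF
  have hdense : Dense Sᶜ := interior_eq_empty_iff_dense_compl.1 hint
  have hoff : ∀ x, x ∉ S → 0 < infDist x S := fun x hx =>
    (hcl.notMem_iff_infDist_pos hne).1 hx
  have hex : ∀ x, 0 < infDist x S → infDist x S ≤ r →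
      ∃ z ∈ F, dist z x ≤ r - infDist x S := fun x h0 h1 => by
    obtain ⟨z, hz, hzr⟩ := exists_infDist_ge_add hcl hne hd h0 h1
    exact ⟨z, mem_frontier_tube_of_infDist_eq hcl hne hr hzr, hz⟩
  have hFne : F.Nonempty := by
    obtain ⟨s, hs⟩ := hne
    obtain ⟨x, hx, hxs⟩ := hdense.exists_dist_lt s hr
    obtain ⟨z, hz, -⟩ := hex x (hoff x hx)
      ((infDist_le_dist_of_mem hs).trans (by rw [dist_comm]; exact hxs.le))
    exact ⟨z, hz⟩
  have hge : ∀ x, r - infDist x S ≤ infDist x F := fun x => by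
    refine (le_infDist hFne).2 fun p hp => ?_
    have h1 := infDist_eq_of_mem_frontier_tube hp
    have h2 := infDist_le_infDist_add_dist (s := S) (x := p) (y := x)
    rw [dist_comm] at h2
    linarith
  have hoffle : ∀ x, x ∉ S → infDist x S ≤ r → infDist x F ≤ r - infDist x S :=
    fun x hx hxr => by
      obtain ⟨z, hz, hzx⟩ := hex x (hoff x hx) hxr
      exact (infDist_le_dist_of_mem hz).trans (by rwa [dist_comm])
  refine ⟨hFne, fun x hx => le_antisymm ?_ (hge x)⟩
  by_cases hxS : x ∈ S
  · rw [infDist_zero_of_mem hxS, sub_zero]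
    refine le_of_forall_pos_le_add fun ε hε => ?_
    obtain ⟨y, hy, hyx⟩ := hdense.exists_dist_lt x (lt_min hε hr)
    have h1 : infDist y S ≤ r := (infDist_le_dist_of_mem hxS).trans
      (by rw [dist_comm]; exact hyx.le.trans (min_le_right _ _))
    have h2 := hoffle y hy h1
    have h3 := infDist_le_infDist_add_dist (s := F) (x := x) (y := y)
    linarith [min_le_left ε r, infDist_nonneg (x := y) (s := S)]
  · exact hoffle x hxS hx

/-- **Lemma.** Let `S ⊆ ℝ²` be nonempty, closed, connected, with empty interior, and
proximally `C¹` of radius `r_S > 0`, and let `r ∈ (0, r_S)`. Then, for the open tubular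
neighborhood `S_r = {d_S < r}`, one has `S = H(S_r) = Σ(S_r) = M(S_r) = Cut(S_r)`. -/
theorem stmt9 (S : Set E2) (rS : ℝ) (hrS : 0 < rS)
    (hne : S.Nonempty) (hcl : IsClosed S) (hconn : IsConnected S)
    (hint : interior S = ∅)
    (hprox : ContDiffOn ℝ 1 (fun x => infDist x S)
      {x | 0 < infDist x S ∧ infDist x S < rS})
    (r : ℝ) (hr : r ∈ Set.Ioo 0 rS) :
    S = highRidge {x | infDist x S < r} ∧
    S = skeleton {x | infDist x S < r} ∧
    S = centralSet {x | infDist x S < r} ∧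
    S = cutLocus {x | infDist x S < r} := by
  obtain ⟨hr0, hrr⟩ := hr
  have hopen : IsOpen {x | 0 < infDist x S ∧ infDist x S < rS} :=
    (isOpen_lt continuous_const (continuous_infDist_pt S)).inter
      (isOpen_lt (continuous_infDist_pt S) continuous_const)
  have hd : ∀ z, 0 < infDist z S → infDist z S ≤ r →
      DifferentiableAt ℝ (fun x => infDist x S) z := fun z h0 h1 =>
    (hprox.differentiableOn one_ne_zero).differentiableAt
      (hopen.mem_nhds ⟨h0, h1.trans_lt hrr⟩)
  obtain ⟨hFne, hg⟩ := infDist_frontier_tube hcl hne hint hr0 hd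
  set Ω := {x | infDist x S < r} with hΩ
  have hΩo : IsOpen Ω := isOpen_lt (continuous_infDist_pt S) continuous_const
  have hSΩ : S ⊆ Ω := fun x hx => by
    rw [hΩ, mem_ofPred_eq, infDist_zero_of_mem hx]; exact hr0
  have hclΩ : ∀ x ∈ closure Ω, infDist x S ≤ r := fun x hx =>
    closure_lt_subset_le (continuous_infDist_pt S) continuous_const hx
  have hzero : ∀ x, infDist x S ≤ 0 → x ∈ S := fun x hx =>
    (hcl.mem_iff_infDist_zero hne).2 (le_antisymm hx infDist_nonneg)
  have hball : ∀ p ρ, ball p ρ ⊆ Ω → ρ ≤ infDist p (frontier Ω) := fun p ρ h =>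
    (le_infDist hFne).2 fun q hq => by
      by_contra! hlt
      have h1 : q ∈ Ω := h (by rwa [mem_ball, dist_comm])
      rw [hΩo.frontier_eq] at hq
      exact hq.2 h1
  have hskel : S = skeleton Ω := by
    refine Subset.antisymm (fun x hx => ?_) ?_
    · have hgx : infDist x (frontier Ω) = r := by
        rw [hg x (hSΩ hx).le, infDist_zero_of_mem hx, sub_zero]
      have hmax : IsLocalMax (fun z => infDist z (frontier Ω)) x := by
        filter_upwards [hΩo.mem_nhds (hSΩ hx)] with z hz
        rw [hgx, hg z (le_of_lt hz)]
        linarith [infDist_nonneg (x := z) (s := S)]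
      obtain ⟨y, hy, hyd, z, hz, hzd, hyz⟩ := exists_ne_of_isLocalMax_infDist isClosed_frontier
        hFne (by rwa [hgx]) hmax
      exact ⟨hSΩ hx, y, ⟨hy, hyd⟩, z, ⟨hz, hzd⟩, hyz⟩
    · rintro x ⟨hxΩ, y, ⟨hy, hyd⟩, z, ⟨hz, hzd⟩, hyz⟩
      by_contra hxS
      obtain ⟨s, hs, hsd⟩ := hcl.exists_infDist_eq_dist hne x
      have hpos : 0 < infDist x S := (hcl.notMem_iff_infDist_pos hne).1 hxS
      have hray : ∀ p ∈ frontier Ω, dist x p = infDist x (frontier Ω) →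
          infDist x S • (p - x) = (r - infDist x S) • (x - s) := fun p hp hpd => by
        rw [hg x (le_of_lt hxΩ)] at hpd
        have h1 : ‖x - s‖ = infDist x S := by rw [hsd, dist_eq_norm]
        have h2 : ‖p - x‖ = r - infDist x S := by rw [← hpd, dist_comm, dist_eq_norm]
        have h3 : r ≤ ‖(x - s) + (p - x)‖ := by
          have h4 : (x - s) + (p - x) = p - s := by abel
          rw [h4, ← dist_eq_norm, ← infDist_eq_of_mem_frontier_tube hp]
          exact infDist_le_dist_of_mem hs
        have h5 : SameRay ℝ (x - s) (p - x) := by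
          rw [sameRay_iff_norm_add]
          exact le_antisymm (norm_add_le _ _) (by linarith)
        rw [← h1, h5.norm_smul_eq, h2, h1]
      have heq := (hray y hy hyd).trans (hray z hz hzd).symm
      exact hyz (sub_left_injective (smul_right_injective E2 hpos.ne' heq))
  refine ⟨?_, hskel, ?_, ?_⟩
  · refine Subset.antisymm (fun x hx => ⟨subset_closure (hSΩ hx), fun z hz => ?_⟩) ?_
    · rw [hg x (hSΩ hx).le, hg z (hclΩ z hz), infDist_zero_of_mem hx]
      linarith [infDist_nonneg (x := z) (s := S)]
    · rintro x ⟨hx, hxmax⟩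
      obtain ⟨s, hs⟩ := hne
      have h1 := hxmax s (subset_closure (hSΩ hs))
      rw [hg x (hclΩ x hx), hg s (hSΩ hs).le, infDist_zero_of_mem hs] at h1
      exact hzero x (by linarith)
  · have hballS : ∀ s ∈ S, ball s r ⊆ Ω := fun s hs y hy =>
      (infDist_le_dist_of_mem hs).trans_lt hy
    refine Subset.antisymm (fun p hp => ⟨r, hr0, hballS p hp, fun q ρ h1 h2 => ?_⟩) ?_
    · have h3 := dist_add_le_of_ball_subset_ball hr0 h1
      have hρ : 0 < ρ := by linarith [dist_nonneg (x := p) (y := q)]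
      have h4 := hball q ρ h2
      rw [hg q (le_of_lt (h2 (mem_ball_self hρ)))] at h4
      have h5 := infDist_nonneg (x := q) (s := S)
      have h6 : dist p q = 0 := by linarith [dist_nonneg (x := p) (y := q)]
      have h7 : ρ = r := by linarith
      rw [h7, dist_eq_zero.1 h6]
    · rintro p ⟨ρ, hρ, hsub, hmax⟩
      obtain ⟨s, hs, hsd⟩ := hcl.exists_infDist_eq_dist hne p
      have h1 := hball p ρ hsub
      rw [hg p (le_of_lt (hsub (mem_ball_self hρ)))] at h1
      have h2 := hmax s r (ball_subset_ball' (by linarith)) (hballS s hs)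
      have h3 := dist_add_le_of_ball_subset_ball hr0 h2.subset
      exact hzero p (by linarith [dist_nonneg (x := s) (y := p)])
  · rw [cutLocus, ← hskel, hcl.closure_eq]
end
end

section
/- Let S ⊆ ℝ² satisfy (H1) and let r ∈ (0, r_S). Then, denoting by S_r := {x ∈ ℝ² : d_S(x) < r} and by (S_r)^c its complement, the identity dist(x, (S_r)^c) = r − d_S(x) holds for every x ∈ S_r (including points x ∈ S). -/
open Metric Set Real

noncomputable section

/-- If `g` lies below a line of slope `a` on the left of `0` and below a line of slope `c` on the
right, both touching at `0`, then differentiability of `g` at `0` forces `a ≤ c`. -/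
lemma le_of_hasDerivAt_of_eventually_le {g : ℝ → ℝ} {g' a c : ℝ} (hg : HasDerivAt g g' 0)
    (hleft : ∀ᶠ t in nhdsWithin (0 : ℝ) (Iio 0), g t ≤ g 0 + a * t)
    (hright : ∀ᶠ t in nhdsWithin (0 : ℝ) (Ioi 0), g t ≤ g 0 + c * t) : a ≤ c := by
  have hs := hasDerivAt_iff_tendsto_slope.1 hg
  have h₁ : a ≤ g' := by
    refine ge_of_tendsto (hs.mono_left (nhdsWithin_mono 0 fun t ht => ne_of_lt ht :
      nhdsWithin (0 : ℝ) (Iio 0) ≤ _)) ?_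
    filter_upwards [hleft, self_mem_nhdsWithin] with t ht (ht0 : t < 0)
    rw [slope_def_field, sub_zero, le_div_iff_of_neg ht0]
    linarith
  have h₂ : g' ≤ c := by
    refine le_of_tendsto (hs.mono_left (nhdsWithin_mono 0 fun t ht => ne_of_gt ht :
      nhdsWithin (0 : ℝ) (Ioi 0) ≤ _)) ?_
    filter_upwards [hright, self_mem_nhdsWithin] with t ht (ht0 : 0 < t)
    rw [slope_def_field, sub_zero, div_le_iff₀ ht0]
    linarith
  exact h₁.trans h₂

section ProperNormedSpace

variable {E : Type*} [NormedAddCommGroup E] [NormedSpace ℝ E] [ProperSpace E]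

/-- At a point of differentiability off `S`, the distance to `S` grows in some direction at unit
rate, so subtracting `c * dist · x` with `c < 1` cannot create a local maximum. -/
lemma not_isLocalMax_infDist_sub {S : Set E} (hne : S.Nonempty) (hcl : IsClosed S) {z : E}
    (hz : 0 < infDist z S) (hd : DifferentiableAt ℝ (fun y => infDist y S) z)
    (x : E) {c : ℝ} (hc0 : 0 ≤ c) (hc1 : c < 1) :
    ¬ IsLocalMax (fun y => infDist y S - c * dist y x) z := by
  intro hmax
  obtain ⟨p, hpS, hp⟩ := hcl.exists_infDist_eq_dist hne z
  set δ := infDist z S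
  set v : E := δ⁻¹ • (z - p) with hv
  have hzp : ‖z - p‖ = δ := by rw [hp, dist_eq_norm]
  have hv1 : ‖v‖ = 1 := by
    rw [hv, norm_smul, hzp, norm_inv, Real.norm_of_nonneg hz.le, inv_mul_cancel₀ hz.ne']
  have hδv : δ • v = z - p := smul_inv_smul₀ hz.ne' _
  have hline : HasDerivAt (fun t : ℝ => z + t • v) v 0 := by
    simpa using ((hasDerivAt_id (0 : ℝ)).smul_const v).const_add z
  have hg : HasDerivAt (fun t : ℝ => infDist (z + t • v) S)
      (fderiv ℝ (fun y => infDist y S) z v) 0 :=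
    hd.hasFDerivAt.comp_hasDerivAt_of_eq 0 hline (by simp)
  refine hc1.not_ge (le_of_hasDerivAt_of_eventually_le hg ?_ ?_)
  · filter_upwards [Ioo_mem_nhdsLT (neg_lt_zero.2 hz)] with t ht
    have hzt : z + t • v - p = (δ + t) • v := by
      rw [add_smul, hδv]; abel
    calc infDist (z + t • v) S ≤ dist (z + t • v) p := infDist_le_dist_of_mem hpS
      _ = δ + t := by
        rw [dist_eq_norm, hzt, norm_smul, hv1, mul_one, Real.norm_of_nonneg (by linarith [ht.1])]
      _ = infDist (z + (0 : ℝ) • v) S + 1 * t := by rw [zero_smul, add_zero, one_mul]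
  · have hcont : Filter.Tendsto (fun t : ℝ => z + t • v) (nhds 0) (nhds z) := by
      simpa using hline.continuousAt.tendsto
    filter_upwards [nhdsWithin_le_nhds (hcont.eventually hmax), self_mem_nhdsWithin]
      with t ht (ht0 : 0 < t)
    have htri : dist (z + t • v) x ≤ t + dist z x := by
      refine (dist_triangle _ z _).trans_eq ?_
      rw [dist_eq_norm (z + t • v), add_sub_cancel_left, norm_smul, hv1, mul_one,
        Real.norm_of_nonneg ht0.le]
    rw [zero_smul, add_zero]
    linarith [mul_le_mul_of_nonneg_left htri hc0]

/-- If the distance to `S` is differentiable on `{0 < d_S < r}`, then from any point of that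
region the level `r` is reached at average rate at least `c`, for every `c < 1`. -/
lemma exists_le_infDist_and_mul_dist_le {S : Set E} (hne : S.Nonempty) (hcl : IsClosed S) {r : ℝ}
    (hd : ∀ z, 0 < infDist z S → infDist z S < r → DifferentiableAt ℝ (fun y => infDist y S) z)
    {x : E} (hx0 : 0 < infDist x S) (hxr : infDist x S < r) {c : ℝ} (hc0 : 0 < c) (hc1 : c < 1) :
    ∃ z, r ≤ infDist z S ∧ c * dist z x ≤ r - infDist x S := by
  set R := (r - infDist x S) / c
  have hcR : c * R = r - infDist x S := mul_div_cancel₀ _ hc0.ne'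
  have hR0 : 0 ≤ R := div_nonneg (sub_nonneg.2 hxr.le) hc0.le
  have hcont : Continuous fun y => infDist y S - c * dist y x :=
    (continuous_infDist_pt S).sub (continuous_const.mul (continuous_id.dist continuous_const))
  obtain ⟨z, hzB, hz⟩ := (isCompact_closedBall x R).exists_isMaxOn
    ⟨x, mem_closedBall_self hR0⟩ hcont.continuousOn
  rw [mem_closedBall] at hzB
  have hzx : infDist x S ≤ infDist z S - c * dist z x := by
    simpa using hz (mem_closedBall_self hR0)
  have hcz : 0 ≤ c * dist z x := mul_nonneg hc0.le dist_nonneg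
  refine ⟨z, ?_, hcR ▸ mul_le_mul_of_nonneg_left hzB hc0.le⟩
  by_contra! hzr
  have hz0 : 0 < infDist z S := by linarith
  have hlt : dist z x < R := lt_of_mul_lt_mul_left (by linarith) hc0.le
  exact not_isLocalMax_infDist_sub hne hcl hz0 (hd z hz0 hzr) x hc0.le hc1
    (hz.isLocalMax (Filter.mem_of_superset (isOpen_ball.mem_nhds (mem_ball.2 hlt))
      ball_subset_closedBall))

lemma nonempty_compl_and_infDist_compl_le {S : Set E} (hne : S.Nonempty) (hcl : IsClosed S)
    {r : ℝ}
    (hd : ∀ z, 0 < infDist z S → infDist z S < r → DifferentiableAt ℝ (fun y => infDist y S) z)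
    {x : E} (hx0 : 0 < infDist x S) (hxr : infDist x S < r) :
    {y | infDist y S < r}ᶜ.Nonempty ∧ infDist x {y | infDist y S < r}ᶜ ≤ r - infDist x S := by
  constructor
  · obtain ⟨z, hz, -⟩ :=
      exists_le_infDist_and_mul_dist_le hne hcl hd hx0 hxr one_half_pos one_half_lt_one
    exact ⟨z, not_lt.2 hz⟩
  have hlim : Filter.Tendsto (fun c : ℝ => c * infDist x {y | infDist y S < r}ᶜ)
      (nhdsWithin 1 (Iio 1)) (nhds (infDist x {y | infDist y S < r}ᶜ)) := by
    have h : Continuous fun c : ℝ => c * infDist x {y | infDist y S < r}ᶜ := by fun_prop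
    simpa using (h.tendsto 1).mono_left nhdsWithin_le_nhds
  refine le_of_tendsto hlim ?_
  filter_upwards [Ioo_mem_nhdsLT (zero_lt_one' ℝ)] with c hc
  obtain ⟨z, hz, hzx⟩ := exists_le_infDist_and_mul_dist_le hne hcl hd hx0 hxr hc.1 hc.2
  have hle : infDist x {y | infDist y S < r}ᶜ ≤ dist x z :=
    infDist_le_dist_of_mem (show z ∈ {y | infDist y S < r}ᶜ from not_lt.2 hz)
  rw [dist_comm] at hle
  exact (mul_le_mul_of_nonneg_left hle hc.1.le).trans hzx

end ProperNormedSpace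

/-- **Lemma.** Let `S ⊆ ℝ²` be nonempty, closed, connected, with empty interior, and
proximally `C¹` of radius `r_S > 0`, and let `r ∈ (0, r_S)`. Then, for the tubular
neighborhood `S_r = {d_S < r}` and its complement `(S_r)ᶜ`, the identity
`dist(x, (S_r)ᶜ) = r − d_S(x)` holds for every `x ∈ S_r` (including points `x ∈ S`). -/
theorem stmt11 (S : Set E2) (rS : ℝ) (hrS : 0 < rS)
    (hne : S.Nonempty) (hcl : IsClosed S) (hconn : IsConnected S)
    (hint : interior S = ∅)
    (hprox : ContDiffOn ℝ 1 (fun x => infDist x S)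
      {x | 0 < infDist x S ∧ infDist x S < rS})
    (r : ℝ) (hr : r ∈ Set.Ioo 0 rS) :
    ∀ x ∈ {x : E2 | infDist x S < r},
      infDist x {x : E2 | infDist x S < r}ᶜ = r - infDist x S := by
  obtain ⟨hr0, hrr⟩ := hr
  have hopen : IsOpen {x : E2 | 0 < infDist x S ∧ infDist x S < rS} :=
    (isOpen_lt continuous_const (continuous_infDist_pt S)).inter
      (isOpen_lt (continuous_infDist_pt S) continuous_const)
  have hd : ∀ z : E2, 0 < infDist z S → infDist z S < r →
      DifferentiableAt ℝ (fun y => infDist y S) z := fun z hz0 hzr =>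
    (hprox.differentiableOn one_ne_zero).differentiableAt
      (hopen.mem_nhds ⟨hz0, hzr.trans hrr⟩)
  have hdense : Dense Sᶜ := interior_eq_empty_iff_dense_compl.1 hint
  have hpos : ∀ y ∈ Sᶜ, 0 < infDist y S := fun y hy => (hcl.notMem_iff_infDist_pos hne).1 hy
  intro x hx
  have hxclosure : x ∈ closure ({y : E2 | infDist y S < r} ∩ Sᶜ) :=
    hdense.open_subset_closure_inter
      (isOpen_lt (continuous_infDist_pt S) continuous_const) hx
  obtain ⟨y, hyr, hyS⟩ := closure_nonempty_iff.1 ⟨x, hxclosure⟩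
  have hne' := (nonempty_compl_and_infDist_compl_le hne hcl hd (hpos y hyS) hyr).1
  refine le_antisymm ?_ ?_
  · exact closure_minimal
      (t := {y : E2 | infDist y {x : E2 | infDist x S < r}ᶜ ≤ r - infDist y S})
      (fun y hy => (nonempty_compl_and_infDist_compl_le hne hcl hd (hpos y hy.2) hy.1).2)
      (isClosed_le (continuous_infDist_pt _) (continuous_const.sub (continuous_infDist_pt S)))
      hxclosure
  · refine (le_infDist hne').2 fun {z} hz => ?_
    have hzr : r ≤ infDist z S := not_lt.1 hz
    have htri : infDist z S ≤ infDist x S + dist z x := infDist_le_infDist_add_dist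
    rw [dist_comm] at htri
    linarith
end
end

section
/- Let S ⊆ ℝ² satisfy (H1), let r ∈ (0, r_S), let p ∈ S, and let a, b ∈ C_r(p). If a and b are distinct and not antipodal (i.e. a + b ≠ 2p), then C_r(p) contains the arc of the circle ∂B_r(p) of length strictly less than rπ joining a and b. -/
open Metric Set Real

noncomputable section

/-- The contact set `C_r(p) = ∂B_r(p) ∩ ∂S_r = {y ∈ ∂S_r : |y − p| = r}`. -/
def contactSet (S : Set E2) (r : ℝ) (p : E2) : Set E2 :=
  Metric.sphere p r ∩ frontier {x | infDist x S < r}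

section Distance

variable {E : Type*} [NormedAddCommGroup E] [InnerProductSpace ℝ E]

/-- Where `infDist · S` is differentiable and positive, it grows at unit rate in the direction
pointing away from a nearest point of `S`. -/
theorem hasDerivAt_infDist_of_nearest {S : Set E} {z q : E} (hq : q ∈ S)
    (hzq : infDist z S = dist z q) (hpos : 0 < infDist z S)
    (hd : DifferentiableAt ℝ (fun x => infDist x S) z) :
    HasDerivAt (fun t : ℝ => infDist (z + t • ((infDist z S)⁻¹ • (z - q))) S) 1 0 := by
  set δ := infDist z S with hδ
  set n := δ⁻¹ • (z - q) with hn
  have hzn : z - q = δ • n := by rw [hn, smul_inv_smul₀ hpos.ne']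
  have hn1 : ‖n‖ = 1 := by
    rw [hn, norm_smul, norm_inv, Real.norm_of_nonneg hpos.le, ← dist_eq_norm, ← hzq,
      inv_mul_cancel₀ hpos.ne']
  have hdiff : DifferentiableAt ℝ (fun t : ℝ => infDist (z + t • n) S) 0 := by
    have hd' : DifferentiableAt ℝ (fun x => infDist x S) (z + (0 : ℝ) • n) := by simpa using hd
    exact hd'.comp (f := fun t : ℝ => z + t • n) (0 : ℝ) (by fun_prop)
  have heq : ∀ t ∈ Icc (-δ) 0, infDist (z + t • n) S = δ + t := by
    rintro t ⟨ht1, ht2⟩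
    apply le_antisymm
    · refine (infDist_le_dist_of_mem hq).trans_eq ?_
      rw [dist_eq_norm, show z + t • n - q = (δ + t) • n by rw [add_smul, ← hzn]; abel,
        norm_smul, hn1, mul_one, Real.norm_of_nonneg (by linarith)]
    · have h := infDist_le_infDist_add_dist (s := S) (x := z) (y := z + t • n)
      rw [dist_eq_norm, show z - (z + t • n) = (-t) • n by rw [neg_smul]; abel, norm_smul, hn1,
        mul_one, Real.norm_of_nonneg (by linarith)] at h
      linarith
  have h0 : (0 : ℝ) ∈ Icc (-δ) 0 := ⟨by linarith, le_rfl⟩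
  have hlin : HasDerivWithinAt (fun t : ℝ => infDist (z + t • n) S) 1 (Icc (-δ) 0) 0 :=
    (((hasDerivAt_id (0 : ℝ)).const_add δ).hasDerivWithinAt).congr heq (heq 0 h0)
  have huniq := uniqueDiffOn_Icc (show -δ < 0 by linarith) 0 h0
  have hder := hdiff.hasDerivAt
  rwa [huniq.eq_deriv _ hder.hasDerivWithinAt hlin] at hder

/-- If `infDist · S` is differentiable wherever it takes values in `(0, r]`, then starting from a
point `x` off `S` it increases by at least `c * h`, for every `c < 1`, within `closedBall x h`,
as long as `infDist x S + h ≤ r`. -/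
theorem exists_infDist_ge_add_mul [ProperSpace E] {S : Set E} (hcl : IsClosed S)
    (hne : S.Nonempty) {r : ℝ}
    (hdiff : ∀ z, 0 < infDist z S → infDist z S ≤ r →
      DifferentiableAt ℝ (fun x => infDist x S) z)
    {x : E} {h c : ℝ} (hh : 0 ≤ h) (hx : 0 < infDist x S) (hxr : infDist x S + h ≤ r)
    (hc0 : 0 ≤ c) (hc1 : c < 1) :
    ∃ z ∈ closedBall x h, infDist x S + c * h ≤ infDist z S := by
  obtain ⟨z, hz, hmax⟩ := (isCompact_closedBall x h).exists_isMaxOn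
    (f := fun z => infDist z S - c * dist z x) ⟨x, mem_closedBall_self hh⟩
    (((continuous_infDist_pt S).sub
      (continuous_const.mul (continuous_id.dist continuous_const))).continuousOn)
  rw [isMaxOn_iff] at hmax
  have hzx : infDist x S + c * dist z x ≤ infDist z S := by
    have := hmax x (mem_closedBall_self hh)
    simp only [dist_self, mul_zero, sub_zero] at this
    linarith
  refine ⟨z, hz, ?_⟩
  rcases (mem_closedBall.1 hz).eq_or_lt with heq | hlt
  · rwa [heq] at hzx
  exfalso
  have hzpos : 0 < infDist z S := by
    have : 0 ≤ c * dist z x := by positivity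
    linarith
  have hzr : infDist z S ≤ r := by
    have := infDist_le_infDist_add_dist (s := S) (x := z) (y := x)
    linarith
  obtain ⟨q, hq, hzq⟩ := hcl.exists_infDist_eq_dist hne z
  have hder := hasDerivAt_infDist_of_nearest hq hzq hzpos (hdiff z hzpos hzr)
  set n := (infDist z S)⁻¹ • (z - q) with hn
  have hn1 : ‖n‖ = 1 := by
    rw [hn, norm_smul, norm_inv, Real.norm_of_nonneg hzpos.le, ← dist_eq_norm, ← hzq,
      inv_mul_cancel₀ hzpos.ne']
  have hslope := (hasDerivAt_iff_tendsto_slope.1 hder).mono_left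
    (nhdsWithin_mono (0 : ℝ) (fun t (ht : t ∈ Ioi (0 : ℝ)) => ne_of_gt ht))
  have hsmall : ∀ᶠ t in nhdsWithin (0 : ℝ) (Ioi 0), t ∈ Ioo (0 : ℝ) (h - dist z x) :=
    Ioo_mem_nhdsGT (by linarith)
  obtain ⟨t, hts, ht0, hth⟩ := ((hslope.eventually (lt_mem_nhds hc1)).and hsmall).exists
  have hdist : dist (z + t • n) x ≤ dist z x + t := by
    have h1 := dist_triangle (z + t • n) z x
    have h2 : dist (z + t • n) z = t := by
      rw [dist_eq_norm, add_sub_cancel_left, norm_smul, hn1, mul_one, Real.norm_of_nonneg ht0.le]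
    linarith
  have hm := hmax (z + t • n) (mem_closedBall.2 (by linarith))
  rw [slope_def_field, sub_zero, lt_div_iff₀ ht0] at hts
  simp only [zero_smul, add_zero] at hts
  nlinarith [mul_le_mul_of_nonneg_left hdist hc0]

/-- A normal segment of `S` issued from `p` stays normal up to length `r`, if `infDist · S` is
differentiable wherever it takes values in `(0, r]`. -/
theorem infDist_ge_of_normal_segment [ProperSpace E] {S : Set E} (hcl : IsClosed S)
    {r : ℝ} (hdiff : ∀ z, 0 < infDist z S → infDist z S ≤ r →
      DifferentiableAt ℝ (fun x => infDist x S) z)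
    {p x y : E} (hp : p ∈ S) {s : ℝ} (hs : 0 < s) (hsr : s ≤ r) (hxp : ‖x - p‖ = s)
    (hx : infDist x S = s) (hy : s • (y - p) = r • (x - p)) :
    r ≤ infDist y S := by
  obtain ⟨z, hz, hmax⟩ := (isCompact_closedBall x (r - s)).exists_isMaxOn
    (f := fun z => infDist z S) ⟨x, mem_closedBall_self (by linarith)⟩
    (continuous_infDist_pt S).continuousOn
  rw [isMaxOn_iff] at hmax
  have hzr : r ≤ infDist z S := by
    have hbound : ∀ c ∈ Ico (0 : ℝ) 1, s + c * (r - s) ≤ infDist z S := by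
      rintro c ⟨hc0, hc1⟩
      obtain ⟨w, hw, hwle⟩ := exists_infDist_ge_add_mul hcl ⟨p, hp⟩ hdiff (x := x) (h := r - s)
        (by linarith) (by linarith) (by linarith) hc0 hc1
      rw [hx] at hwle
      exact hwle.trans (hmax w hw)
    have hlim : Filter.Tendsto (fun c : ℝ => s + c * (r - s)) (nhdsWithin 1 (Iio 1))
        (nhds (s + 1 * (r - s))) :=
      (Continuous.tendsto (by fun_prop) 1).mono_left nhdsWithin_le_nhds
    have := le_of_tendsto hlim
      (Filter.mem_of_superset (Ico_mem_nhdsLT zero_lt_one) hbound)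
    linarith
  have hzp : r ≤ ‖(x - p) + (z - x)‖ := by
    rw [show (x - p) + (z - x) = z - p by abel, ← dist_eq_norm]
    exact hzr.trans (infDist_le_dist_of_mem hp)
  have hzx : ‖z - x‖ ≤ r - s := by rw [← dist_eq_norm]; exact hz
  have hray : SameRay ℝ (x - p) (z - x) := by
    rw [sameRay_iff_norm_add]
    apply le_antisymm (norm_add_le _ _)
    linarith
  have hnorm : ‖z - x‖ = r - s := by
    have := norm_add_le (x - p) (z - x)
    linarith
  have hsm := hray.norm_smul_eq
  rw [hxp, hnorm] at hsm
  have hzy : z = y := by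
    apply sub_left_injective (b := p)
    apply smul_right_injective E hs.ne'
    change s • (z - p) = s • (y - p)
    rw [hy, show z - p = (z - x) + (x - p) by abel, smul_add, hsm, ← add_smul]
    congr 1
    ring
  rwa [← hzy]

end Distance

/-- **Lemma.** Let `S ⊆ ℝ²` be nonempty, closed, connected, with empty interior, and
proximally `C¹` of radius `r_S > 0`; let `r ∈ (0, r_S)`, `p ∈ S`, and `a, b ∈ C_r(p)`.
If `a` and `b` are distinct and not antipodal, then `C_r(p)` contains the arc of
`∂B_r(p)` of length `< rπ` joining `a` and `b`, i.e. all points of `∂B_r(p)` lying in the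
convex cone spanned by `a − p` and `b − p` with vertex `p`. -/
theorem stmt12 (S : Set E2) (rS : ℝ) (hrS : 0 < rS)
    (hne : S.Nonempty) (hcl : IsClosed S) (hconn : IsConnected S)
    (hint : interior S = ∅)
    (hprox : ContDiffOn ℝ 1 (fun x => infDist x S)
      {x | 0 < infDist x S ∧ infDist x S < rS})
    (r : ℝ) (hr : r ∈ Set.Ioo 0 rS) (p : E2) (hp : p ∈ S)
    (a b : E2) (ha : a ∈ contactSet S r p) (hb : b ∈ contactSet S r p)
    (hab : a ≠ b) (hanti : a + b ≠ p + p) :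
    ∀ y ∈ Metric.sphere p r,
      (∃ α β : ℝ, 0 ≤ α ∧ 0 ≤ β ∧ y - p = α • (a - p) + β • (b - p)) →
        y ∈ contactSet S r p := by
  obtain ⟨hr0, hrlt⟩ := hr
  have hopen : IsOpen {x : E2 | infDist x S < r} :=
    isOpen_lt (continuous_infDist_pt S) continuous_const
  have hUopen : IsOpen {x : E2 | 0 < infDist x S ∧ infDist x S < rS} :=
    (isOpen_lt continuous_const (continuous_infDist_pt S)).inter
      (isOpen_lt (continuous_infDist_pt S) continuous_const)
  have hdiff : ∀ z : E2, 0 < infDist z S → infDist z S ≤ r →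
      DifferentiableAt ℝ (fun x => infDist x S) z := fun z h0 h1 =>
    (hprox.differentiableOn one_ne_zero).differentiableAt
      (hUopen.mem_nhds ⟨h0, h1.trans_lt hrlt⟩)
  have key : ∀ c ∈ contactSet S r p, ∀ q ∈ S,
      2 * inner ℝ (q - p) (c - p) ≤ ‖q - p‖ ^ 2 := by
    rintro c ⟨hcs, hcf⟩ q hq
    have hc1 : r ≤ infDist c S := by
      rw [hopen.frontier_eq] at hcf
      exact not_lt.1 hcf.2
    have hc2 : r ≤ ‖(q - p) - (c - p)‖ := by
      rw [sub_sub_sub_cancel_right, ← dist_eq_norm, dist_comm]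
      exact hc1.trans (infDist_le_dist_of_mem hq)
    have hc3 : ‖c - p‖ = r := by rw [← dist_eq_norm]; exact hcs
    have hsq := norm_sub_sq_real (q - p) (c - p)
    rw [hc3] at hsq
    nlinarith
  rintro y hy ⟨α, β, hα, hβ, hyab⟩
  have hyr : ‖y - p‖ = r := by rw [← dist_eq_norm]; exact hy
  have har : ‖a - p‖ = r := by rw [← dist_eq_norm]; exact ha.1
  have hbr : ‖b - p‖ = r := by rw [← dist_eq_norm]; exact hb.1
  have hsum : 1 ≤ α + β := by
    have h := norm_add_le (α • (a - p)) (β • (b - p))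
    rw [← hyab, norm_smul, norm_smul, har, hbr, hyr, Real.norm_of_nonneg hα,
      Real.norm_of_nonneg hβ] at h
    nlinarith
  set σ := α + β with hσ
  have hσ0 : 0 < σ := by linarith
  set x := p + σ⁻¹ • (y - p) with hxdef
  have hxp' : x - p = σ⁻¹ • (y - p) := by rw [hxdef, add_sub_cancel_left]
  have hxp : ‖x - p‖ = σ⁻¹ * r := by
    rw [hxp', norm_smul, hyr, Real.norm_of_nonneg (by positivity)]
  have hxS : infDist x S = σ⁻¹ * r := by
    apply le_antisymm
    · rw [← hxp, ← dist_eq_norm]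
      exact infDist_le_dist_of_mem hp
    · rw [le_infDist hne]
      intro q hq
      have hin : 2 * inner ℝ (q - p) (x - p) ≤ ‖q - p‖ ^ 2 := by
        rw [hxp', inner_smul_right, hyab, inner_add_right, inner_smul_right, inner_smul_right,
          ← mul_le_mul_iff_right₀ hσ0]
        have h1 := mul_le_mul_of_nonneg_left (key a ha q hq) hα
        have h2 := mul_le_mul_of_nonneg_left (key b hb q hq) hβ
        field_simp
        rw [hσ]
        linarith
      have hsq := norm_sub_sq_real (q - p) (x - p)
      rw [sub_sub_sub_cancel_right] at hsq
      rw [← hxp, dist_comm, dist_eq_norm]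
      apply le_of_sq_le_sq _ (norm_nonneg _)
      linarith
  have hyge : r ≤ infDist y S := by
    refine infDist_ge_of_normal_segment hcl hdiff hp (by positivity) ?_ hxp hxS ?_
    · exact mul_le_of_le_one_left hr0.le (inv_le_one_of_one_le₀ hsum)
    · rw [hxp', smul_smul, mul_comm]
  refine ⟨hy, ?_⟩
  rw [hopen.frontier_eq]
  refine ⟨?_, not_lt.2 hyge⟩
  have hball : ball p r ⊆ {x | infDist x S < r} := fun w hw =>
    (infDist_le_dist_of_mem hp).trans_lt hw
  apply closure_mono hball
  rw [closure_ball p hr0.ne']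
  exact sphere_subset_closedBall hy
end
end
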